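/- arXiv:math/0012205 — 6 statements merged into one kernel-verified Lean document; each statement's English description precedes it below -/
import Mathlib

section
/- Let E be a real Banach space, let Ω ⊆ ℝ^p be a nonempty open set, and let n ≥ 1. Suppose f, g ∈ C^n(Ω, E) and k : Ω → ℝ satisfy f(x) = k(x) g(x) for every x ∈ Ω. If g(x) ≠ 0 for every x ∈ Ω, then k ∈ C^n(Ω, ℝ). -/
open Set Filter Topology

/-- If `f = k • g` on `s` near `x`, with `f` and `g` of class `C^n` within `s` at `x` and `g x ≠ 0`,
then the scalar factor `k` is `C^n` within `s` at `x`. -/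
theorem contDiffWithinAt_of_eq_smul {F E : Type*} [NormedAddCommGroup F] [NormedSpace ℝ F]
    [NormedAddCommGroup E] [NormedSpace ℝ E] {n : WithTop ℕ∞} {s : Set F} {x : F}
    {f g : F → E} {k : F → ℝ} (hf : ContDiffWithinAt ℝ n f s x) (hg : ContDiffWithinAt ℝ n g s x)
    (heq : ∀ᶠ y in 𝓝[s] x, f y = k y • g y) (hx : f x = k x • g x) (hgx : g x ≠ 0) :
    ContDiffWithinAt ℝ n k s x := by
  obtain ⟨φ, hφ⟩ := SeparatingDual.exists_ne_zero (R := ℝ) hgx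
  have hφf : ContDiffWithinAt ℝ n (fun y => φ (f y)) s x := hf.continuousLinearMap_comp φ
  have hφg : ContDiffWithinAt ℝ n (fun y => φ (g y)) s x := hg.continuousLinearMap_comp φ
  have hne : ∀ᶠ y in 𝓝[s] x, φ (g y) ≠ 0 := hφg.continuousWithinAt.eventually_ne hφ
  refine (hφf.div hφg hφ).congr_of_eventuallyEq ?_ ?_
  · filter_upwards [hne, heq] with y hy hfy
    simp [hfy, hy]
  · simp [hx, hφ]

/-- If `f, g ∈ C^n(Ω, E)` satisfy `f = k·g` on `Ω` with `g` nonvanishing on `Ω`,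
then `k ∈ C^n(Ω, ℝ)`. -/
theorem quotient_factor_contDiffOn {p n : ℕ} {E : Type*} [NormedAddCommGroup E]
    [NormedSpace ℝ E] [CompleteSpace E] {Ω : Set (Fin p → ℝ)}
    (hΩ : IsOpen Ω) (hΩne : Ω.Nonempty) (hn : 1 ≤ n)
    (f g : (Fin p → ℝ) → E) (k : (Fin p → ℝ) → ℝ)
    (hf : ContDiffOn ℝ n f Ω) (hg : ContDiffOn ℝ n g Ω)
    (heq : ∀ x ∈ Ω, f x = k x • g x) (hg0 : ∀ x ∈ Ω, g x ≠ 0) :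
    ContDiffOn ℝ n k Ω := fun x hx =>
  contDiffWithinAt_of_eq_smul (hf x hx) (hg x hx)
    (eventually_mem_nhdsWithin.mono heq) (heq x hx) (hg0 x hx)
end

section
/- (Whitney's extension theorem, Banach-space valued.) Let E be a real Banach space, n ∈ ℕ, A a closed subset of ℝ^p, and suppose that to each a ∈ A corresponds a polynomial function P_a : ℝ^p → E of degree at most n. For C ⊆ A and δ > 0 let ρ(C, δ) be the supremum of the numbers ‖D^i P_a(b) − D^i P_b(b)‖ · |a − b|^{i−n} · (n−i)! over i = 0, …, n and a, b ∈ C with 0 < |a − b| ≤ δ, where |x| = max_j |x_j|. If ρ(C, δ) → 0 as δ → 0+ for each compact subset C of A, then there exists a map g : ℝ^p → E of class C^n such that D^i g(a) = D^i P_a(a) for i = 0, …, n and every a ∈ A. -/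
open Set Filter Topology

section ScaledDerivatives

variable {V F : Type*} [NormedAddCommGroup V] [NormedSpace ℝ V]
  [NormedAddCommGroup F] [NormedSpace ℝ F]

theorem ContDiffAt.exists_isOpen_contDiffOn {n : ℕ} {f : V → F} {x : V}
    (hf : ContDiffAt ℝ n f x) : ∃ s, IsOpen s ∧ x ∈ s ∧ ContDiffOn ℝ n f s := by
  obtain ⟨u, hu, hfu⟩ := hf.contDiffOn le_rfl (by simp)
  obtain ⟨s, hsu, hs, hxs⟩ := mem_nhds_iff.1 hu
  exact ⟨s, hs, hxs, hfu.mono hsu⟩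

/-- Leibniz bound for functions that are only smooth near a point. -/
theorem norm_iteratedFDeriv_smul_le_of_contDiffAt {n : ℕ} {f : V → ℝ} {g : V → F} {x : V}
    (hf : ContDiffAt ℝ n f x) (hg : ContDiffAt ℝ n g x) {k : ℕ} (hk : k ≤ n) :
    ‖iteratedFDeriv ℝ k (fun y => f y • g y) x‖ ≤ ∑ i ∈ Finset.range (k + 1),
      (k.choose i : ℝ) * ‖iteratedFDeriv ℝ i f x‖ * ‖iteratedFDeriv ℝ (k - i) g x‖ := by
  obtain ⟨s, hs, hxs, hfs⟩ := hf.exists_isOpen_contDiffOn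
  obtain ⟨t, ht, hxt, hgt⟩ := hg.exists_isOpen_contDiffOn
  have hst := hs.inter ht
  have hx : x ∈ s ∩ t := ⟨hxs, hxt⟩
  have h := norm_iteratedFDerivWithin_smul_le (hfs.mono inter_subset_left)
    (hgt.mono inter_subset_right) hst.uniqueDiffOn hx (n := k) (by exact_mod_cast hk)
  simpa only [iteratedFDerivWithin_of_isOpen _ hst hx] using h

/-- Products of functions whose derivatives are controlled at the scale `r`. -/
theorem scaled_iteratedFDeriv_smul_le {n : ℕ} {f : V → ℝ} {g : V → F} {x : V} {r C D : ℝ}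
    (hr : 0 ≤ r) (hC : 0 ≤ C) (hD : 0 ≤ D)
    (hf : ContDiffAt ℝ n f x) (hg : ContDiffAt ℝ n g x)
    (hfC : ∀ k ≤ n, r ^ k * ‖iteratedFDeriv ℝ k f x‖ ≤ C)
    (hgD : ∀ k ≤ n, r ^ k * ‖iteratedFDeriv ℝ k g x‖ ≤ D) {k : ℕ} (hk : k ≤ n) :
    r ^ k * ‖iteratedFDeriv ℝ k (fun y => f y • g y) x‖ ≤ 2 ^ n * (C * D) := by
  calc r ^ k * ‖iteratedFDeriv ℝ k (fun y => f y • g y) x‖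
      ≤ r ^ k * ∑ i ∈ Finset.range (k + 1),
        (k.choose i : ℝ) * ‖iteratedFDeriv ℝ i f x‖ * ‖iteratedFDeriv ℝ (k - i) g x‖ := by
        gcongr
        exact norm_iteratedFDeriv_smul_le_of_contDiffAt hf hg hk
    _ = ∑ i ∈ Finset.range (k + 1), (k.choose i : ℝ) *
        ((r ^ i * ‖iteratedFDeriv ℝ i f x‖) *
          (r ^ (k - i) * ‖iteratedFDeriv ℝ (k - i) g x‖)) := by
        rw [Finset.mul_sum]
        refine Finset.sum_congr rfl fun i hi => ?_
        have hik : i ≤ k := Nat.lt_succ_iff.1 (Finset.mem_range.1 hi)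
        rw [← pow_mul_pow_sub r hik]
        ring
    _ ≤ ∑ i ∈ Finset.range (k + 1), (k.choose i : ℝ) * (C * D) := by
        refine Finset.sum_le_sum fun i hi => ?_
        have hik : i ≤ k := Nat.lt_succ_iff.1 (Finset.mem_range.1 hi)
        have h1 := hfC i (hik.trans hk)
        have h2 := hgD (k - i) ((Nat.sub_le _ _).trans hk)
        gcongr
    _ = 2 ^ k * (C * D) := by
        rw [← Finset.sum_mul]
        congr 1
        exact_mod_cast Nat.sum_range_choose k
    _ ≤ 2 ^ n * (C * D) := by
        gcongr
        norm_num

theorem norm_iteratedFDeriv_inv_le {t : ℝ} (ht : 1 ≤ t) (k : ℕ) :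
    ‖iteratedFDeriv ℝ k (fun s : ℝ => s⁻¹) t‖ ≤ k.factorial := by
  have ht0 : 0 < t := by linarith
  rw [norm_iteratedFDeriv_eq_norm_iteratedDeriv, iteratedDeriv_eq_iterate]
  have h := iter_deriv_inv k t
  change deriv^[k] (fun s : ℝ => s⁻¹) t = _ at h
  rw [h, norm_mul, norm_mul, norm_pow, norm_neg, norm_one, one_pow, one_mul,
    Real.norm_natCast, Real.norm_of_nonneg (zpow_nonneg ht0.le _)]
  exact mul_le_of_le_one_right (Nat.cast_nonneg _) (zpow_le_one_of_nonpos₀ ht (by omega))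

/-- Inverses of functions whose derivatives are controlled at the scale `r`. -/
theorem scaled_iteratedFDeriv_inv_le {n : ℕ} {f : V → ℝ} {x : V} {r C : ℝ}
    (hr : 0 < r) (hC : 1 ≤ C) (hf : ContDiffAt ℝ n f x) (hfx : 1 ≤ f x)
    (hfC : ∀ k ≤ n, r ^ k * ‖iteratedFDeriv ℝ k f x‖ ≤ C) {k : ℕ} (hk : k ≤ n) :
    r ^ k * ‖iteratedFDeriv ℝ k (fun y => (f y)⁻¹) x‖ ≤ n.factorial * n.factorial * C ^ n := by
  obtain ⟨s, hs, hxs, hfs⟩ := hf.exists_isOpen_contDiffOn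
  have hx0 : f x ≠ 0 := by linarith
  have hst : IsOpen (s ∩ f ⁻¹' {0}ᶜ) :=
    hfs.continuousOn.isOpen_inter_preimage hs isOpen_compl_singleton
  have hx : x ∈ s ∩ f ⁻¹' {0}ᶜ := ⟨hxs, hx0⟩
  have h0 : IsOpen ({0}ᶜ : Set ℝ) := isOpen_compl_singleton
  have hinv : ContDiffOn ℝ n (fun s : ℝ => s⁻¹) {0}ᶜ :=
    fun t ht => (contDiffAt_inv ℝ ht).contDiffWithinAt
  have h := norm_iteratedFDerivWithin_comp_le (n := k) (C := n.factorial) (D := C / r)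
    hinv (hfs.mono inter_subset_left)
    (by exact_mod_cast hk) h0.uniqueDiffOn hst.uniqueDiffOn (fun y hy => hy.2) hx
    (fun i hi => by
      rw [iteratedFDerivWithin_of_isOpen _ h0 hx0]
      exact (norm_iteratedFDeriv_inv_le hfx i).trans
        (by exact_mod_cast Nat.factorial_le (hi.trans hk)))
    (fun i hi1 hik => by
      rw [iteratedFDerivWithin_of_isOpen _ hst hx, div_pow, le_div_iff₀ (by positivity), mul_comm]
      exact (hfC i (hik.trans hk)).trans (le_self_pow₀ hC (by omega)))
  rw [iteratedFDerivWithin_of_isOpen _ hst hx] at h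
  calc r ^ k * ‖iteratedFDeriv ℝ k (fun y => (f y)⁻¹) x‖
      ≤ r ^ k * (k.factorial * n.factorial * (C / r) ^ k) := by gcongr; exact h
    _ = k.factorial * n.factorial * C ^ k := by
        rw [div_pow]
        field_simp
    _ ≤ n.factorial * n.factorial * C ^ n := by
        have h1 : (k.factorial : ℝ) ≤ n.factorial := by exact_mod_cast Nat.factorial_le hk
        have h2 : C ^ k ≤ C ^ n := pow_le_pow_right₀ hC hk
        gcongr

/-- Finite sums of functions whose derivatives are controlled at the scale `r`. -/
theorem scaled_iteratedFDeriv_sum_le {ι : Type*} {n : ℕ} {f : ι → V → F} {x : V} {r C : ℝ}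
    (hr : 0 ≤ r) (S : Finset ι) (hf : ∀ s ∈ S, ContDiffAt ℝ n (f s) x)
    (hfC : ∀ s ∈ S, ∀ k ≤ n, r ^ k * ‖iteratedFDeriv ℝ k (f s) x‖ ≤ C) {k : ℕ} (hk : k ≤ n) :
    r ^ k * ‖iteratedFDeriv ℝ k (fun y => ∑ s ∈ S, f s y) x‖ ≤ S.card * C := by
  rw [iteratedFDeriv_fun_sum_apply fun s hs => (hf s hs).of_le (by exact_mod_cast hk)]
  calc r ^ k * ‖∑ s ∈ S, iteratedFDeriv ℝ k (f s) x‖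
      ≤ r ^ k * ∑ s ∈ S, ‖iteratedFDeriv ℝ k (f s) x‖ := by
        gcongr
        exact norm_sum_le _ _
    _ = ∑ s ∈ S, r ^ k * ‖iteratedFDeriv ℝ k (f s) x‖ := Finset.mul_sum _ _ _
    _ ≤ S.card * C := by
        rw [← nsmul_eq_mul]
        exact Finset.sum_le_card_nsmul _ _ _ fun s hs => hfC s hs k hk

end ScaledDerivatives

section Polynomials

variable {V F : Type*} [NormedAddCommGroup V] [NormedSpace ℝ V]
  [NormedAddCommGroup F] [NormedSpace ℝ F]

/-- Smooth functions all of whose derivatives of order larger than `n` vanish. -/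
def IsPolynomialOfDegreeLE (n : ℕ) (f : V → F) : Prop :=
  (∀ k : ℕ, ContDiff ℝ k f) ∧ ∀ k > n, ∀ x, iteratedFDeriv ℝ k f x = 0

namespace IsPolynomialOfDegreeLE

theorem mono {m n : ℕ} {f : V → F} (hf : IsPolynomialOfDegreeLE m f) (hmn : m ≤ n) :
    IsPolynomialOfDegreeLE n f :=
  ⟨hf.1, fun k hk => hf.2 k (by omega)⟩

theorem const (c : F) : IsPolynomialOfDegreeLE 0 (fun _ : V => c) :=
  ⟨fun _ => contDiff_const, fun k hk x => by
    rw [iteratedFDeriv_const_of_ne (by omega)]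
    rfl⟩

theorem smul {m n : ℕ} {f : V → ℝ} {g : V → F} (hf : IsPolynomialOfDegreeLE m f)
    (hg : IsPolynomialOfDegreeLE n g) : IsPolynomialOfDegreeLE (m + n) (fun x => f x • g x) := by
  refine ⟨fun k => (hf.1 k).smul (hg.1 k), fun k hk x => ?_⟩
  rw [← norm_le_zero_iff]
  refine (norm_iteratedFDeriv_smul_le (hf.1 k) (hg.1 k) x le_rfl).trans_eq
    (Finset.sum_eq_zero fun i _ => ?_)
  rcases lt_or_ge m i with h | h
  · simp [hf.2 i h x]
  · simp [hg.2 (k - i) (by omega) x]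

theorem sum {ι : Type*} {n : ℕ} {S : Finset ι} {f : ι → V → F}
    (hf : ∀ s ∈ S, IsPolynomialOfDegreeLE n (f s)) :
    IsPolynomialOfDegreeLE n (fun x => ∑ s ∈ S, f s x) := by
  refine ⟨fun k => ContDiff.sum fun s hs => (hf s hs).1 k, fun k hk x => ?_⟩
  rw [iteratedFDeriv_fun_sum_apply fun s hs => ((hf s hs).1 k).contDiffAt]
  exact Finset.sum_eq_zero fun s hs => (hf s hs).2 k hk x

theorem sub {n : ℕ} {f g : V → F} (hf : IsPolynomialOfDegreeLE n f)
    (hg : IsPolynomialOfDegreeLE n g) : IsPolynomialOfDegreeLE n (fun x => f x - g x) := by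
  refine ⟨fun k => (hf.1 k).sub (hg.1 k), fun k hk x => ?_⟩
  rw [fun_iteratedFDeriv_sub_apply (hf.1 k).contDiffAt (hg.1 k).contDiffAt, hf.2 k hk, hg.2 k hk,
    sub_zero]

theorem continuousLinearMap (f : V →L[ℝ] F) : IsPolynomialOfDegreeLE 1 f := by
  refine ⟨fun _ => f.contDiff, fun k hk x => ?_⟩
  obtain ⟨j, rfl⟩ : ∃ j, k = j + 2 := ⟨k - 2, by omega⟩
  rw [← norm_eq_zero, ← norm_iteratedFDeriv_fderiv]
  have : fderiv ℝ f = fun _ => f := funext fun x => f.fderiv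
  rw [this, iteratedFDeriv_const_of_ne (by omega)]
  simp

theorem pow {n : ℕ} {f : V → ℝ} (hf : IsPolynomialOfDegreeLE n f) (l : ℕ) :
    IsPolynomialOfDegreeLE (l * n) (fun x => f x ^ l) := by
  induction l with
  | zero => simpa using const (V := V) (1 : ℝ)
  | succ l ih => simpa only [pow_succ, Nat.succ_mul, smul_eq_mul] using ih.smul hf

theorem prod {ι : Type*} {S : Finset ι} {d : ι → ℕ} {f : ι → V → ℝ}
    (hf : ∀ s ∈ S, IsPolynomialOfDegreeLE (d s) (f s)) :
    IsPolynomialOfDegreeLE (∑ s ∈ S, d s) (fun x => ∏ s ∈ S, f s x) := by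
  classical
  induction S using Finset.induction_on with
  | empty => simpa using const (V := V) (1 : ℝ)
  | insert a S ha ih =>
    simp only [Finset.sum_insert ha, Finset.prod_insert ha]
    exact (hf a (Finset.mem_insert_self _ _)).smul
      (ih fun s hs => hf s (Finset.mem_insert_of_mem hs))

theorem of_monomials {p n : ℕ} {S : Finset (Fin p → ℕ)} {c : (Fin p → ℕ) → F}
    (hS : ∀ lam ∈ S, (∑ i, lam i) ≤ n) :
    IsPolynomialOfDegreeLE n
      (fun x : Fin p → ℝ => ∑ lam ∈ S, (∏ i, x i ^ lam i) • c lam) := by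
  refine sum fun lam hlam => ?_
  have hprod := prod (S := Finset.univ) fun i _ =>
    (continuousLinearMap (ContinuousLinearMap.proj (R := ℝ) (φ := fun _ : Fin p => ℝ) i)).pow
      (lam i)
  simp only [mul_one, ContinuousLinearMap.proj_apply] at hprod
  exact (hprod.smul (const (c lam))).mono (by simpa using hS lam hlam)

/-- Taylor estimate: bounds at one point for all derivatives of a polynomial propagate to the ball
whose radius is the scale of these bounds. -/
theorem scaled_iteratedFDeriv_le {n : ℕ} {f : V → F} (hf : IsPolynomialOfDegreeLE n f)
    {b : V} {r B : ℝ} (hr : 0 ≤ r) (hB : 0 ≤ B)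
    (hfB : ∀ k ≤ n, r ^ k * ‖iteratedFDeriv ℝ k f b‖ ≤ B) {k : ℕ} (hk : k ≤ n) {x : V}
    (hx : ‖x - b‖ ≤ r) : r ^ k * ‖iteratedFDeriv ℝ k f x‖ ≤ (n + 1) * B := by
  suffices h : ∀ j ≤ n + 1, ∀ x ∈ Metric.closedBall b r,
      r ^ (n + 1 - j) * ‖iteratedFDeriv ℝ (n + 1 - j) f x‖ ≤ j * B by
    have := h (n + 1 - k) (by omega) x (by simpa [dist_eq_norm] using hx)
    rw [show n + 1 - (n + 1 - k) = k by omega] at this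
    refine this.trans ?_
    gcongr
    exact_mod_cast Nat.sub_le _ _
  intro j
  induction j with
  | zero =>
    intro _ x _
    simp [hf.2 (n + 1) (by omega)]
  | succ j ih =>
    intro hj x hx
    obtain ⟨l, hl⟩ : ∃ l, l + j = n := ⟨n - j, by omega⟩
    have hl0 : n + 1 - (j + 1) = l := by omega
    have hl1 : n + 1 - j = l + 1 := by omega
    rw [hl0]
    rw [hl1] at ih
    rcases hr.eq_or_lt with rfl | hr
    · have hxb : x = b := by simpa using hx
      rw [hxb]
      refine (hfB l (by omega)).trans (le_mul_of_one_le_left hB ?_)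
      push_cast
      linarith [(Nat.cast_nonneg j : (0 : ℝ) ≤ j)]
    have hmv := (convex_closedBall b r).norm_image_sub_le_of_norm_fderiv_le (𝕜 := ℝ)
      (f := iteratedFDeriv ℝ l f) (C := j * B / r ^ (l + 1))
      (fun y _ => ((hf.1 (l + 1)).contDiffAt.differentiableAt_iteratedFDeriv
        (by exact_mod_cast Nat.lt_succ_self l)))
      (fun y hy => by
        rw [norm_fderiv_iteratedFDeriv, le_div_iff₀ (by positivity), mul_comm]
        exact ih (by omega) y hy)
      (Metric.mem_closedBall_self hr.le) hx
    have hxr : ‖x - b‖ ≤ r := by simpa [dist_eq_norm] using hx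
    have hle : ‖iteratedFDeriv ℝ l f x‖ ≤
        ‖iteratedFDeriv ℝ l f b‖ + j * B / r ^ (l + 1) * r := by
      have h1 := norm_le_norm_add_norm_sub' (iteratedFDeriv ℝ l f x) (iteratedFDeriv ℝ l f b)
      have h2 : j * B / r ^ (l + 1) * ‖x - b‖ ≤ j * B / r ^ (l + 1) * r := by gcongr
      linarith
    calc r ^ l * ‖iteratedFDeriv ℝ l f x‖
        ≤ r ^ l * (‖iteratedFDeriv ℝ l f b‖ + j * B / r ^ (l + 1) * r) := by gcongr
      _ = r ^ l * ‖iteratedFDeriv ℝ l f b‖ + j * B := by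
          rw [pow_succ]
          field_simp
      _ ≤ ((j + 1 : ℕ) : ℝ) * B := by
          push_cast
          linarith [hfB l (by omega)]

end IsPolynomialOfDegreeLE

end Polynomials

section Gluing

variable {V E : Type*} [NormedAddCommGroup V] [NormedSpace ℝ V]
  [NormedAddCommGroup E] [NormedSpace ℝ E]

open Classical in
/-- A function which is smooth off a closed set `A` and whose derivatives off `A` are compatible
with a Taylor field `P` on `A` is smooth with the prescribed derivatives on `A`. -/
theorem contDiff_of_taylor_field {n : ℕ} {A : Set V} (hA : IsClosed A) {P : V → V → E} {g : V → E}
    (hP : ∀ a ∈ A, ∀ k : ℕ, ContDiff ℝ k (P a)) (hgA : ∀ a ∈ A, g a = P a a)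
    (hg : ∀ x ∉ A, ContDiffAt ℝ n g x)
    (hgP : ∀ a ∈ A, ∀ i ≤ n, ∀ ε > 0, ∀ᶠ x in 𝓝 a,
      ‖(if x ∈ A then iteratedFDeriv ℝ i (P x) x else iteratedFDeriv ℝ i g x) -
        iteratedFDeriv ℝ i (P a) x‖ ≤ ε * ‖x - a‖ ^ (n - i)) :
    ContDiff ℝ n g ∧ ∀ a ∈ A, ∀ i ≤ n, iteratedFDeriv ℝ i g a = iteratedFDeriv ℝ i (P a) a := by
  set q : V → FormalMultilinearSeries ℝ V E := fun x i =>
    if x ∈ A then iteratedFDeriv ℝ i (P x) x else iteratedFDeriv ℝ i g x with hq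
  have hqA : ∀ a ∈ A, ∀ i, q a i = iteratedFDeriv ℝ i (P a) a := fun a ha i => if_pos ha
  have hqc : ∀ x ∉ A, ∀ i, q x i = iteratedFDeriv ℝ i g x := fun x hx i => if_neg hx
  have hqe : ∀ x ∉ A, ∀ i, (fun y => q y i) =ᶠ[𝓝 x] iteratedFDeriv ℝ i g := fun x hx i => by
    filter_upwards [hA.isOpen_compl.mem_nhds hx] with y hy using hqc y hy i
  have hfd : ∀ m < n, ∀ x, HasFDerivAt (fun y => q y m) (q x (m + 1)).curryLeft x := by
    intro m hm x
    by_cases hx : x ∈ A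
    · have h1 : HasFDerivAt (iteratedFDeriv ℝ m (P x)) (q x (m + 1)).curryLeft x := by
        rw [hqA x hx]
        exact ((hP x hx (m + 1)).contDiffAt.differentiableAt_iteratedFDeriv
          (by exact_mod_cast Nat.lt_succ_self m)).hasFDerivAt
      have h2 : HasFDerivAt (fun y => q y m - iteratedFDeriv ℝ m (P x) y)
          (0 : V →L[ℝ] ContinuousMultilinearMap ℝ (fun _ : Fin m => V) E) x := by
        refine .of_isLittleO (Asymptotics.isLittleO_iff.2 fun ε hε => ?_)
        filter_upwards [hgP x hx m hm.le ε hε, Metric.closedBall_mem_nhds x one_pos] with y hy hy1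
        rw [mem_closedBall_iff_norm] at hy1
        simp only [hqA x hx, sub_self, sub_zero, zero_apply]
        refine hy.trans ?_
        gcongr
        exact pow_le_of_le_one (norm_nonneg _) hy1 (by omega)
      simpa using h1.fun_add h2
    · rw [hqc x hx]
      exact ((hg x hx).differentiableAt_iteratedFDeriv
        (by exact_mod_cast hm)).hasFDerivAt.congr_of_eventuallyEq (hqe x hx m)
  have hqn : ∀ x, ContinuousAt (fun y => q y n) x := by
    intro x
    by_cases hx : x ∈ A
    · have h1 : ContinuousAt (iteratedFDeriv ℝ n (P x)) x :=
        ((hP x hx n).continuous_iteratedFDeriv le_rfl).continuousAt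
      have h2 : Tendsto (fun y => q y n - iteratedFDeriv ℝ n (P x) y) (𝓝 x) (𝓝 0) := by
        rw [Metric.tendsto_nhds]
        intro ε hε
        filter_upwards [hgP x hx n le_rfl (ε / 2) (by positivity)] with y hy
        rw [dist_zero_right]
        refine lt_of_le_of_lt hy ?_
        simp only [Nat.sub_self, pow_zero]
        linarith
      have h3 := h2.add h1
      simp only [sub_add_cancel, zero_add] at h3
      simpa only [ContinuousAt, hqA x hx] using h3
    · exact ((hg x hx).continuousAt_iteratedFDeriv le_rfl).congr (hqe x hx n).symm
  have hT : HasFTaylorSeriesUpTo n g q := by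
    refine ⟨fun x => ?_, fun m hm x => hfd m (by exact_mod_cast hm) x, fun m hm => ?_⟩
    · by_cases hx : x ∈ A
      · rw [hqA x hx, hgA x hx]
        rfl
      · rw [hqc x hx]
        rfl
    · have hmn : m ≤ n := by exact_mod_cast hm
      rcases hmn.eq_or_lt with rfl | hmn
      · exact continuous_iff_continuousAt.2 hqn
      · exact continuous_iff_continuousAt.2 fun x => (hfd m hmn x).continuousAt
  refine ⟨HasFTaylorSeriesUpTo.contDiff (n := (n : ℕ∞)) (by exact_mod_cast hT),
    fun a ha i hi => ?_⟩
  rw [← hT.eq_iteratedFDeriv (by exact_mod_cast hi), hqA a ha]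

end Gluing

section Partition

variable {V : Type*} [NormedAddCommGroup V] [NormedSpace ℝ V]

theorem exists_ncard_le_of_separated [FiniteDimensional ℝ V] (R : ℝ) {c : ℝ} (hc : 0 < c) :
    ∃ N : ℕ, ∀ (x : V) (r : ℝ) (S : Set V), 0 < r → (∀ s ∈ S, ‖s - x‖ ≤ R * r) →
      S.Pairwise (fun s t => c * r ≤ ‖s - t‖) → S.Finite ∧ S.ncard ≤ N := by
  have : ProperSpace V := FiniteDimensional.proper ℝ V
  obtain ⟨T, -, hT, hcov⟩ :=
    finite_cover_balls_of_compact (isCompact_closedBall (0 : V) R) (half_pos hc)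
  refine ⟨T.ncard, fun x r S hr hSR hS => ?_⟩
  have hz : ∀ s ∈ S, ∃ z ∈ T, r⁻¹ • (s - x) ∈ Metric.ball z (c / 2) := by
    intro s hs
    have h : r⁻¹ • (s - x) ∈ Metric.closedBall (0 : V) R := by
      rw [mem_closedBall_zero_iff, norm_smul, norm_inv, Real.norm_of_nonneg hr.le,
        inv_mul_le_iff₀ hr, mul_comm]
      exact hSR s hs
    simpa using hcov h
  choose! z hzT hz using hz
  have hinj : S.InjOn z := by
    intro s hs t ht hst
    by_contra hne
    have h1 := hz s hs
    have h2 := hz t ht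
    rw [← hst] at h2
    have h3 : ‖r⁻¹ • (s - x) - r⁻¹ • (t - x)‖ < c := by
      rw [← dist_eq_norm]
      exact (dist_triangle_right _ _ (z s)).trans_lt
        (by linarith [Metric.mem_ball.1 h1, Metric.mem_ball.1 h2])
    rw [← smul_sub, sub_sub_sub_cancel_right, norm_smul, norm_inv, Real.norm_of_nonneg hr.le,
      inv_mul_lt_iff₀ hr, mul_comm] at h3
    exact absurd (hS hs ht hne) (not_le.2 h3)
  exact ⟨Set.Finite.of_injOn hzT hinj hT, Set.ncard_le_ncard_of_injOn z hzT hinj hT⟩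

/-- Maximal separated sets, where the separation is measured by a variable scale `h`. -/
theorem exists_maximal_separated {V : Type*} [NormedAddCommGroup V] (U : Set V) (h : V → ℝ) :
    ∃ S ⊆ U, S.Pairwise (fun s t => h s ≤ ‖s - t‖ ∧ h t ≤ ‖s - t‖) ∧
      ∀ x ∈ U, ∃ s ∈ S, x = s ∨ ‖x - s‖ < h x ∨ ‖x - s‖ < h s := by
  obtain ⟨S, hS⟩ := zorn_subset
    {S : Set V | S ⊆ U ∧ S.Pairwise (fun s t => h s ≤ ‖s - t‖ ∧ h t ≤ ‖s - t‖)} (by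
      intro c hcS hc
      exact ⟨⋃₀ c, ⟨sUnion_subset fun s hs => (hcS hs).1,
        (pairwise_sUnion hc.directedOn).2 fun s hs => (hcS hs).2⟩,
        fun s hs => subset_sUnion_of_mem hs⟩)
  refine ⟨S, hS.prop.1, hS.prop.2, fun x hx => ?_⟩
  by_contra! hcon
  have hmem : insert x S ∈
      {S : Set V | S ⊆ U ∧ S.Pairwise (fun s t => h s ≤ ‖s - t‖ ∧ h t ≤ ‖s - t‖)} := by
    refine ⟨insert_subset hx hS.prop.1, hS.prop.2.insert fun s hs _ => ?_⟩
    have hs' := (hcon s hs).2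
    rw [norm_sub_rev s x]
    exact ⟨hs', hs'.symm⟩
  have hxS : x ∈ S := hS.le_of_ge hmem (subset_insert _ _) (mem_insert _ _)
  exact (hcon x hxS).1 rfl

theorem ContDiffBump.exists_norm_iteratedFDeriv_le [FiniteDimensional ℝ V] {c : V}
    (f : ContDiffBump c) (n : ℕ) :
    ∃ M, 0 ≤ M ∧ ∀ k ≤ n, ∀ x, ‖iteratedFDeriv ℝ k f x‖ ≤ M := by
  have h : ∀ k : ℕ, ∃ C, ∀ x, ‖iteratedFDeriv ℝ k f x‖ ≤ C := fun k =>
    (f.hasCompactSupport.iteratedFDeriv k).exists_bound_of_continuous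
      (f.contDiff.continuous_iteratedFDeriv (n := k) le_rfl)
  choose C hC using h
  have hC0 : ∀ k, 0 ≤ C k := fun k => (norm_nonneg _).trans (hC k c)
  exact ⟨∑ k ∈ Finset.range (n + 1), C k, Finset.sum_nonneg fun k _ => hC0 k,
    fun k hk x => (hC k x).trans
      (Finset.single_le_sum (fun k _ => hC0 k) (Finset.mem_range.2 (Nat.lt_succ_of_le hk)))⟩

theorem scaled_iteratedFDeriv_comp_smul_sub {n : ℕ} {f : V → ℝ} (hf : ContDiff ℝ n f) {M : ℝ}
    (hfM : ∀ k ≤ n, ∀ x, ‖iteratedFDeriv ℝ k f x‖ ≤ M) {r t : ℝ} (hr : 0 ≤ r)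
    (ht : 0 < t) (hrt : r ≤ 2 * t) (s x : V) {k : ℕ} (hk : k ≤ n) :
    r ^ k * ‖iteratedFDeriv ℝ k (fun y => f (t⁻¹ • (y - s))) x‖ ≤ 2 ^ n * M := by
  have h1 := iteratedFDeriv_comp_sub (𝕜 := ℝ) (f := fun w => f (t⁻¹ • w)) k s x
  rw [iteratedFDeriv_comp_const_smul t⁻¹ (hf.of_le (by exact_mod_cast hk))] at h1
  rw [h1, norm_smul, norm_pow, norm_inv, Real.norm_of_nonneg ht.le, ← mul_assoc, ← mul_pow]
  have h2 : (r * t⁻¹) ^ k ≤ 2 ^ n := by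
    have : r * t⁻¹ ≤ 2 := by
      rw [← div_eq_mul_inv, div_le_iff₀ ht]
      exact hrt
    calc (r * t⁻¹) ^ k ≤ 2 ^ k := by gcongr
      _ ≤ 2 ^ n := by
        gcongr
        norm_num
  gcongr
  exact hfM k hk _

open Metric in
/-- Whitney's partition of unity on the complement of a closed set. -/
theorem exists_whitney_partition [FiniteDimensional ℝ V] (n : ℕ) {A : Set V} (hA : IsClosed A)
    (hne : A.Nonempty) :
    ∃ (φ : V → V → ℝ) (F : V → Finset V) (M : ℝ) (N : ℕ), 0 ≤ M ∧ ∀ x ∉ A,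
      (F x).card ≤ N ∧ (∀ s ∈ F x, ‖s - x‖ ≤ 3 / 2 * infDist x A) ∧
      (∀ᶠ y in 𝓝 x, ∀ s ∉ F x, φ s y = 0) ∧ (∀ᶠ y in 𝓝 x, ∑ s ∈ F x, φ s y = 1) ∧
      ∀ s ∈ F x, ContDiffAt ℝ n (φ s) x ∧
        ∀ k ≤ n, infDist x A ^ k * ‖iteratedFDeriv ℝ k (φ s) x‖ ≤ M := by
  classical
  set d : V → ℝ := fun x => infDist x A with hd
  have hd_pos : ∀ x, x ∉ A ↔ 0 < d x := fun x => hA.notMem_iff_infDist_pos hne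
  have hd_lip : ∀ x y, d x ≤ d y + ‖x - y‖ := fun x y => by
    rw [← dist_eq_norm]
    exact infDist_le_infDist_add_dist
  obtain ⟨S, hSU, hSsep, hScov⟩ := exists_maximal_separated Aᶜ (fun x => d x / 5)
  have hSd : ∀ s ∈ S, 0 < d s := fun s hs => (hd_pos s).1 (hSU hs)
  obtain ⟨N, hN⟩ := exists_ncard_le_of_separated (V := V) (3 / 2) (c := 1 / 10) (by norm_num)
  set F' : V → Set V := fun x => {s | s ∈ S ∧ ‖s - x‖ ≤ 3 / 2 * d x ∧ d x ≤ 2 * d s} with hF'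
  have hF'N : ∀ x ∉ A, (F' x).Finite ∧ (F' x).ncard ≤ N := fun x hx =>
    hN x (d x) (F' x) ((hd_pos x).1 hx) (fun s hs => hs.2.1) fun s hs t ht hst => by
      have := (hSsep hs.1 ht.1 hst).1
      have := hs.2.2
      linarith
  set F : V → Finset V := fun x => if h : (F' x).Finite then h.toFinset else ∅ with hF
  have hFmem : ∀ x ∉ A, ∀ s, s ∈ F x ↔ s ∈ F' x := fun x hx s => by
    simp [hF, (hF'N x hx).1]
  have hFcard : ∀ x ∉ A, (F x).card ≤ N := fun x hx => by
    have := (hF'N x hx).2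
    rw [show F x = (hF'N x hx).1.toFinset from dif_pos _]
    rwa [Set.ncard_eq_toFinset_card _ (hF'N x hx).1] at this
  let μ : ContDiffBump (0 : V) := ⟨1 / 4, 1 / 2, by norm_num, by norm_num⟩
  obtain ⟨M, hM0, hM⟩ := μ.exists_norm_iteratedFDeriv_le n
  set u : V → V → ℝ := fun s y => if s ∈ S then μ ((d s)⁻¹ • (y - s)) else 0 with hu
  have hu0 : ∀ s y, 0 ≤ u s y := fun s y => by
    simp only [hu]
    split_ifs
    exacts [μ.nonneg, le_rfl]
  have huS : ∀ s ∈ S, u s = fun y => μ ((d s)⁻¹ • (y - s)) := fun s hs => by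
    funext y
    exact if_pos hs
  have hnorm : ∀ s ∈ S, ∀ y, ‖(d s)⁻¹ • (y - s)‖ = ‖y - s‖ / d s := fun s hs y => by
    rw [norm_smul, norm_inv, Real.norm_of_nonneg (hSd s hs).le, div_eq_inv_mul]
  have hball : ∀ x y, y ∈ ball x (d x / 4) → 3 / 4 * d x < d y ∧ d y < 5 / 4 * d x := by
    intro x y hy
    rw [mem_ball_iff_norm] at hy
    have h1 := hd_lip y x
    have h2 := hd_lip x y
    rw [norm_sub_rev] at h2
    constructor <;> linarith
  have husupp : ∀ x ∉ A, ∀ y ∈ ball x (d x / 4), ∀ s ∉ F x, u s y = 0 := by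
    intro x hx y hy s hs
    by_contra hne0
    have hsS : s ∈ S := by
      by_contra h
      exact hne0 (if_neg h)
    rw [huS s hsS] at hne0
    have hlt : ‖y - s‖ / d s < 1 / 2 := by
      by_contra! h
      refine hne0 (μ.zero_of_le_dist ?_)
      rw [dist_zero_right, hnorm s hsS]
      exact h
    rw [div_lt_iff₀ (hSd s hsS)] at hlt
    obtain ⟨hy1, hy2⟩ := hball x y hy
    rw [mem_ball_iff_norm] at hy
    have h1 := hd_lip y s
    have h2 := hd_lip s y
    rw [norm_sub_rev] at h2
    have h3 := norm_sub_le_norm_sub_add_norm_sub s y x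
    rw [norm_sub_rev s y] at h3
    refine hs ((hFmem x hx s).2 ⟨hsS, ?_, ?_⟩) <;> linarith
  have hucov : ∀ y ∉ A, ∃ s ∈ S, u s y = 1 := by
    intro y hy
    obtain ⟨s, hs, hys⟩ := hScov y hy
    refine ⟨s, hs, ?_⟩
    rw [huS s hs]
    refine μ.one_of_mem_closedBall ?_
    rw [mem_closedBall_zero_iff, hnorm s hs, div_le_iff₀ (hSd s hs)]
    change ‖y - s‖ ≤ 1 / 4 * d s
    have hds := hSd s hs
    rcases hys with rfl | h | h
    · rw [sub_self, norm_zero]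
      positivity
    · have := hd_lip y s
      linarith
    · linarith
  have hsum : ∀ x ∉ A, ∀ y ∈ ball x (d x / 4), ∑ᶠ s, u s y = ∑ s ∈ F x, u s y :=
    fun x hx y hy => finsum_eq_sum_of_support_subset _ fun s hs => by
      by_contra h
      exact hs (husupp x hx y hy s h)
  have hsum1 : ∀ x ∉ A, ∀ y ∈ ball x (d x / 4), 1 ≤ ∑ s ∈ F x, u s y := by
    intro x hx y hy
    have hxd := (hd_pos x).1 hx
    have hyA : y ∉ A := (hd_pos y).2 (by linarith [(hball x y hy).1])
    obtain ⟨s, -, hsy⟩ := hucov y hyA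
    have hsF : s ∈ F x := by
      by_contra h
      rw [husupp x hx y hy s h] at hsy
      exact zero_ne_one hsy
    rw [← hsy]
    exact Finset.single_le_sum (f := fun s => u s y) (fun t _ => hu0 t y) hsF
  have hball_nhds : ∀ x ∉ A, ball x (d x / 4) ∈ 𝓝 x := fun x hx =>
    ball_mem_nhds x (by linarith [(hd_pos x).1 hx])
  have huC : ∀ s ∈ S, ContDiff ℝ n (u s) := fun s hs => by
    rw [huS s hs]
    exact μ.contDiff.comp ((contDiff_id.sub contDiff_const).const_smul _)
  have huM : ∀ x ∉ A, ∀ s ∈ F x, ∀ k ≤ n, d x ^ k * ‖iteratedFDeriv ℝ k (u s) x‖ ≤ 2 ^ n * M := by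
    intro x hx s hs k hk
    obtain ⟨hsS, -, hsx⟩ := (hFmem x hx s).1 hs
    rw [huS s hsS]
    exact scaled_iteratedFDeriv_comp_smul_sub μ.contDiff hM ((hd_pos x).1 hx).le
      (hSd s hsS) hsx s x hk
  set C : ℝ := N * (2 ^ n * M) + 1 with hC
  have hC1 : 1 ≤ C := le_add_of_nonneg_left (by positivity)
  refine ⟨fun s y => (∑ᶠ t, u t y)⁻¹ * u s y, F,
    2 ^ n * ((n.factorial * n.factorial * C ^ n) * (2 ^ n * M)), N, by positivity,
    fun x hx => ⟨hFcard x hx, fun s hs => ((hFmem x hx s).1 hs).2.1, ?_, ?_, fun s hs => ?_⟩⟩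
  · filter_upwards [hball_nhds x hx] with y hy s hs
    rw [husupp x hx y hy s hs, mul_zero]
  · filter_upwards [hball_nhds x hx] with y hy
    rw [← Finset.mul_sum, hsum x hx y hy]
    exact inv_mul_cancel₀ (by linarith [hsum1 x hx y hy])
  · have hxx : x ∈ ball x (d x / 4) := mem_of_mem_nhds (hball_nhds x hx)
    have hFS : ∀ t ∈ F x, t ∈ S := fun t ht => ((hFmem x hx t).1 ht).1
    have hev : (fun y => (∑ᶠ t, u t y)⁻¹ * u s y) =ᶠ[𝓝 x]
        fun y => (∑ t ∈ F x, u t y)⁻¹ • u s y := by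
      filter_upwards [hball_nhds x hx] with y hy
      rw [hsum x hx y hy, smul_eq_mul]
    have hσ : ContDiffAt ℝ n (fun y => ∑ t ∈ F x, u t y) x :=
      ContDiffAt.sum fun t ht => (huC t (hFS t ht)).contDiffAt
    have hσ1 := hsum1 x hx x hxx
    have hσinv : ContDiffAt ℝ n (fun y => (∑ t ∈ F x, u t y)⁻¹) x :=
      hσ.inv (by linarith)
    have hus := (huC s (hFS s hs)).contDiffAt (x := x)
    refine ⟨(hσinv.smul hus).congr_of_eventuallyEq hev, fun k hk => ?_⟩
    rw [(hev.iteratedFDeriv ℝ k).eq_of_nhds]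
    have hdx := (hd_pos x).1 hx
    refine scaled_iteratedFDeriv_smul_le hdx.le (by positivity) (by positivity) hσinv hus
      (fun j hj => scaled_iteratedFDeriv_inv_le hdx hC1 hσ hσ1 (fun i hi => ?_) hj)
      (huM x hx s hs) hk
    refine (scaled_iteratedFDeriv_sum_le hdx.le (F x)
      (fun t ht => (huC t (hFS t ht)).contDiffAt) (huM x hx) hi).trans ?_
    have : ((F x).card : ℝ) ≤ N := by exact_mod_cast hFcard x hx
    calc ((F x).card : ℝ) * (2 ^ n * M) ≤ N * (2 ^ n * M) := by gcongr
      _ ≤ C := by rw [hC]; linarith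

end Partition

section Extension

variable {V E : Type*} [NormedAddCommGroup V] [NormedSpace ℝ V]
  [NormedAddCommGroup E] [NormedSpace ℝ E]

/-- Difference of two polynomials of a Whitney field near their base points. -/
theorem scaled_iteratedFDeriv_sub_le {n : ℕ} {f g : V → E} (hf : IsPolynomialOfDegreeLE n f)
    (hg : IsPolynomialOfDegreeLE n g) {b x : V} {r t η : ℝ} (ht : 0 ≤ t) (htr : t ≤ r)
    (hη : 0 ≤ η)
    (hfg : ∀ k ≤ n, ‖iteratedFDeriv ℝ k f b - iteratedFDeriv ℝ k g b‖ ≤ η * t ^ (n - k))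
    (hx : ‖x - b‖ ≤ r) {k : ℕ} (hk : k ≤ n) :
    r ^ k * ‖iteratedFDeriv ℝ k (fun y => f y - g y) x‖ ≤ (n + 1) * (η * r ^ n) := by
  have hr : 0 ≤ r := ht.trans htr
  refine (hf.sub hg).scaled_iteratedFDeriv_le hr (by positivity) (fun j hj => ?_) hk hx
  rw [fun_iteratedFDeriv_sub_apply (hf.1 j).contDiffAt (hg.1 j).contDiffAt]
  calc r ^ j * ‖iteratedFDeriv ℝ j f b - iteratedFDeriv ℝ j g b‖
      ≤ r ^ j * (η * r ^ (n - j)) := by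
        gcongr
        exact (hfg j hj).trans (by gcongr)
    _ = η * r ^ n := by
        rw [← pow_mul_pow_sub r hj]
        ring

/-- Comparison of a function patched together by a partition of unity with one fixed function. -/
theorem scaled_iteratedFDeriv_partition_sub_le {ι : Type*} {n N : ℕ} {S : Finset ι}
    {φ : ι → V → ℝ} {Q : ι → V → E} {g f : V → E} {x : V} {r M B : ℝ} (hr : 0 ≤ r)
    (hM : 0 ≤ M) (hB : 0 ≤ B) (hSN : S.card ≤ N)
    (hg : g =ᶠ[𝓝 x] fun y => ∑ s ∈ S, φ s y • Q s y)
    (hφ1 : ∀ᶠ y in 𝓝 x, ∑ s ∈ S, φ s y = 1)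
    (hφ : ∀ s ∈ S, ContDiffAt ℝ n (φ s) x)
    (hφM : ∀ s ∈ S, ∀ k ≤ n, r ^ k * ‖iteratedFDeriv ℝ k (φ s) x‖ ≤ M)
    (hQ : ∀ s ∈ S, ContDiffAt ℝ n (Q s) x) (hf : ContDiffAt ℝ n f x)
    (hQB : ∀ s ∈ S, ∀ k ≤ n, r ^ k * ‖iteratedFDeriv ℝ k (fun y => Q s y - f y) x‖ ≤ B)
    {k : ℕ} (hk : k ≤ n) :
    r ^ k * ‖iteratedFDeriv ℝ k g x - iteratedFDeriv ℝ k f x‖ ≤ N * (2 ^ n * (M * B)) := by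
  have hkn : (k : WithTop ℕ∞) ≤ n := by exact_mod_cast hk
  have hgc : ContDiffAt ℝ n g x :=
    (ContDiffAt.sum fun s hs => (hφ s hs).smul (hQ s hs)).congr_of_eventuallyEq hg
  have hev : (fun y => g y - f y) =ᶠ[𝓝 x] fun y => ∑ s ∈ S, φ s y • (Q s y - f y) := by
    filter_upwards [hg, hφ1] with y hy hy1
    simp only [smul_sub, Finset.sum_sub_distrib]
    rw [← Finset.sum_smul, hy1, one_smul, hy]
  rw [← fun_iteratedFDeriv_sub_apply (hgc.of_le hkn) (hf.of_le hkn),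
    (hev.iteratedFDeriv ℝ k).eq_of_nhds]
  refine (scaled_iteratedFDeriv_sum_le hr S (fun s hs => (hφ s hs).smul ((hQ s hs).sub hf))
    (fun s hs j hj => scaled_iteratedFDeriv_smul_le hr hM hB (hφ s hs) ((hQ s hs).sub hf)
      (hφM s hs) (hQB s hs) hj) hk).trans ?_
  gcongr

open Metric in
/-- Whitney's extension theorem over a finite-dimensional normed space. -/
theorem whitney_extension_of_isPolynomialOfDegreeLE [FiniteDimensional ℝ V] {n : ℕ} {A : Set V}
    (hA : IsClosed A) {P : V → V → E} (hP : ∀ a ∈ A, IsPolynomialOfDegreeLE n (P a))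
    (hPA : ∀ c ∈ A, ∀ η > 0, ∃ δ > 0, ∀ a ∈ A, ∀ b ∈ A, ‖a - c‖ ≤ 1 → ‖b - c‖ ≤ 1 →
      ‖a - b‖ ≤ δ → ∀ i ≤ n,
      ‖iteratedFDeriv ℝ i (P a) b - iteratedFDeriv ℝ i (P b) b‖ ≤ η * ‖a - b‖ ^ (n - i)) :
    ∃ g : V → E, ContDiff ℝ n g ∧
      ∀ a ∈ A, ∀ i ≤ n, iteratedFDeriv ℝ i g a = iteratedFDeriv ℝ i (P a) a := by
  classical
  have : ProperSpace V := FiniteDimensional.proper ℝ V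
  rcases A.eq_empty_or_nonempty with rfl | hne
  · exact ⟨fun _ => 0, contDiff_const, by simp⟩
  obtain ⟨φ, F, M, N, hM, hφ⟩ := exists_whitney_partition n hA hne
  choose π hπA hπ using fun x : V => hA.exists_infDist_eq_dist hne x
  set g : V → E := fun x => if x ∈ A then P x x else ∑ s ∈ F x, φ s x • P (π s) x with hg
  have hgA : ∀ a ∈ A, g a = P a a := fun a ha => if_pos ha
  have hgx : ∀ x ∉ A, g =ᶠ[𝓝 x] fun y => ∑ s ∈ F x, φ s y • P (π s) y := by
    intro x hx
    filter_upwards [hA.isOpen_compl.mem_nhds hx, (hφ x hx).2.2.1] with y hy hyF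
    have hsupp : ∀ T : Finset V, (∀ s ∉ T, φ s y = 0) →
        ∑ᶠ s, φ s y • P (π s) y = ∑ s ∈ T, φ s y • P (π s) y := fun T hT =>
      finsum_eq_sum_of_support_subset _ fun s hs => by
        by_contra h
        exact hs (by simp [hT s h])
    rw [← hsupp _ hyF, hsupp (F y) (hφ y hy).2.2.1.self_of_nhds]
    exact if_neg hy
  have hPc : ∀ a ∈ A, ∀ x, ContDiffAt ℝ n (P a) x := fun a ha x => ((hP a ha).1 n).contDiffAt
  refine ⟨g, contDiff_of_taylor_field hA (fun a ha => (hP a ha).1) hgA (fun x hx => ?_) ?_⟩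
  · exact (ContDiffAt.sum fun s hs => ((hφ x hx).2.2.2.2 s hs).1.smul
      (hPc _ (hπA s) x)).congr_of_eventuallyEq (hgx x hx)
  intro c hc i hi ε hε
  set L : ℝ := N * (2 ^ n * (M * ((n + 1) * 5 ^ n))) + (n + 1) * 2 ^ n + 1 with hL
  have hL1 : 1 ≤ L := le_add_of_nonneg_left (by positivity)
  have hη : 0 < ε / L := by positivity
  obtain ⟨δ, hδ, hPδ⟩ := hPA c hc (ε / L) hη
  have hδ' : 0 < min δ 1 / 5 := by positivity
  filter_upwards [ball_mem_nhds c hδ'] with x hx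
  rw [mem_ball_iff_norm, lt_div_iff₀ (by norm_num)] at hx
  have hxδ : ‖x - c‖ * 5 < δ := hx.trans_le (min_le_left _ _)
  have hx1 : ‖x - c‖ * 5 < 1 := hx.trans_le (min_le_right _ _)
  have hx0 := norm_nonneg (x - c)
  by_cases hxA : x ∈ A
  · rw [if_pos hxA, norm_sub_rev, norm_sub_rev x c]
    refine (hPδ c hc x hxA (by simp) (by linarith) ?_ i hi).trans ?_
    · rw [norm_sub_rev]
      linarith
    · gcongr
      exact div_le_self hε.le hL1
  rw [if_neg hxA]
  set d := infDist x A with hd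
  have hd0 : 0 < d := (hA.notMem_iff_infDist_pos hne).1 hxA
  have hdx : d ≤ ‖x - c‖ := by
    rw [← dist_eq_norm]
    exact infDist_le_dist_of_mem hc
  have hxb : ‖x - π x‖ = d := by rw [hd, hπ x, dist_eq_norm]
  have hbc : ‖π x - c‖ ≤ 2 * ‖x - c‖ := by
    have := norm_sub_le_norm_sub_add_norm_sub (π x) x c
    rw [norm_sub_rev (π x) x] at this
    linarith
  obtain ⟨hFN, hFd, -, hφ1, hφC⟩ := hφ x hxA
  have hnear : ∀ s ∈ F x, ‖π s - x‖ ≤ 4 * d := by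
    intro s hs
    have h1 := hFd s hs
    have h2 : ‖π s - s‖ ≤ d + ‖s - x‖ := by
      rw [norm_sub_rev, ← dist_eq_norm, ← hπ s, ← dist_eq_norm]
      exact infDist_le_infDist_add_dist
    have := norm_sub_le_norm_sub_add_norm_sub (π s) s x
    linarith
  have hQ : ∀ s ∈ F x, ∀ k ≤ n, d ^ k * ‖iteratedFDeriv ℝ k (fun y => P (π s) y - P (π x) y) x‖ ≤
      (n + 1) * (ε / L * (5 * d) ^ n) := by
    intro s hs k hk
    have h1 := hnear s hs
    have h2 : ‖π s - π x‖ ≤ 5 * d := by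
      have := norm_sub_le_norm_sub_add_norm_sub (π s) x (π x)
      linarith
    have h3 : ‖π s - c‖ ≤ 5 * ‖x - c‖ := by
      have := norm_sub_le_norm_sub_add_norm_sub (π s) x c
      linarith
    refine le_trans ?_ (scaled_iteratedFDeriv_sub_le (hP _ (hπA s)) (hP _ (hπA x))
      (norm_nonneg _) h2 hη.le
      (hPδ _ (hπA s) _ (hπA x) (by linarith) (by linarith) (by linarith))
      (by linarith : ‖x - π x‖ ≤ 5 * d) hk)
    gcongr
    linarith
  have hgb := scaled_iteratedFDeriv_partition_sub_le hd0.le hM (by positivity) hFN (hgx x hxA) hφ1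
    (fun s hs => (hφC s hs).1) (fun s hs => (hφC s hs).2) (fun s _ => hPc _ (hπA s) x)
    (hPc _ (hπA x) x) hQ hi
  have hbc' := scaled_iteratedFDeriv_sub_le (hP _ (hπA x)) (hP c hc) (norm_nonneg _) hbc hη.le
    (hPδ _ (hπA x) c hc (by linarith) (by simp) (by linarith))
    (by linarith : ‖x - c‖ ≤ 2 * ‖x - c‖) hi
  rw [fun_iteratedFDeriv_sub_apply ((hP _ (hπA x)).1 i).contDiffAt
    ((hP c hc).1 i).contDiffAt] at hbc'
  have hρ0 : 0 < ‖x - c‖ := hd0.trans_le hdx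
  have hgb' : ‖iteratedFDeriv ℝ i g x - iteratedFDeriv ℝ i (P (π x)) x‖ ≤
      N * (2 ^ n * (M * ((n + 1) * 5 ^ n))) * (ε / L) * ‖x - c‖ ^ (n - i) := by
    have h : ‖iteratedFDeriv ℝ i g x - iteratedFDeriv ℝ i (P (π x)) x‖ ≤
        N * (2 ^ n * (M * ((n + 1) * 5 ^ n))) * (ε / L) * d ^ (n - i) := by
      refine le_of_mul_le_mul_left (hgb.trans_eq ?_) (pow_pos hd0 i)
      rw [mul_pow, ← pow_mul_pow_sub d hi]
      ring
    exact h.trans (by gcongr)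
  have hbc'' : ‖iteratedFDeriv ℝ i (P (π x)) x - iteratedFDeriv ℝ i (P c) x‖ ≤
      (n + 1) * 2 ^ n * (ε / L) * ‖x - c‖ ^ (n - i) := by
    refine le_of_mul_le_mul_left (le_trans ?_ (hbc'.trans_eq ?_)) (pow_pos hρ0 i)
    · gcongr
      linarith
    · rw [mul_pow, ← pow_mul_pow_sub ‖x - c‖ hi]
      ring
  calc ‖iteratedFDeriv ℝ i g x - iteratedFDeriv ℝ i (P c) x‖
      ≤ _ := norm_sub_le_norm_sub_add_norm_sub _ (iteratedFDeriv ℝ i (P (π x)) x) _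
    _ ≤ _ := add_le_add hgb' hbc''
    _ = (L - 1) * (ε / L) * ‖x - c‖ ^ (n - i) := by
        rw [hL]
        ring
    _ ≤ L * (ε / L) * ‖x - c‖ ^ (n - i) := by
        gcongr
        linarith
    _ = ε * ‖x - c‖ ^ (n - i) := by
        rw [mul_div_cancel₀ _ (by linarith : L ≠ 0)]

end Extension

/-- Whitney's extension theorem, Banach-space valued. -/
theorem whitney_extension {p n : ℕ} {E : Type*} [NormedAddCommGroup E]
    [NormedSpace ℝ E] [CompleteSpace E]
    (A : Set (Fin p → ℝ)) (hA : IsClosed A)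
    (P : (Fin p → ℝ) → (Fin p → ℝ) → E)
    -- each `P a` is a polynomial function of degree at most `n`
    (hP : ∀ a ∈ A, ∃ (S : Finset (Fin p → ℕ)) (c : (Fin p → ℕ) → E),
        (∀ lam ∈ S, (∑ i, lam i) ≤ n) ∧
        ∀ x, P a x = ∑ lam ∈ S, (∏ i, x i ^ lam i) • c lam)
    -- `ρ(C, δ) → 0` as `δ → 0+` for each compact `C ⊆ A`
    (hρ : ∀ C ⊆ A, IsCompact C → ∀ ε > 0, ∃ δ > 0, ∀ i ≤ n, ∀ a ∈ C, ∀ b ∈ C,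
        0 < ‖a - b‖ → ‖a - b‖ ≤ δ →
        ‖iteratedFDeriv ℝ i (P a) b - iteratedFDeriv ℝ i (P b) b‖ *
            ((n - i).factorial : ℝ) / ‖a - b‖ ^ (n - i) ≤ ε) :
    ∃ g : (Fin p → ℝ) → E, ContDiff ℝ n g ∧
      ∀ a ∈ A, ∀ i ≤ n, iteratedFDeriv ℝ i g a = iteratedFDeriv ℝ i (P a) a := by
  refine whitney_extension_of_isPolynomialOfDegreeLE hA (fun a ha => ?_) fun c hc η hη => ?_
  · obtain ⟨S, e, hS, hPe⟩ := hP a ha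
    rw [funext hPe]
    exact .of_monomials hS
  obtain ⟨δ, hδ, h⟩ := hρ (A ∩ Metric.closedBall c 1) inter_subset_left
    ((isCompact_closedBall c 1).inter_left hA) η hη
  refine ⟨δ, hδ, fun a ha b hb hac hbc hab i hi => ?_⟩
  rcases (norm_nonneg (a - b)).eq_or_lt with h0 | h0
  · rw [sub_eq_zero.1 (norm_eq_zero.1 h0.symm), sub_self, norm_zero]
    positivity
  · have h1 := h i hi a ⟨ha, mem_closedBall_iff_norm.2 hac⟩ b ⟨hb, mem_closedBall_iff_norm.2 hbc⟩
      h0 hab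
    rw [div_le_iff₀ (by positivity)] at h1
    refine le_trans (le_mul_of_one_le_right (norm_nonneg _) ?_) h1
    exact_mod_cast Nat.one_le_iff_ne_zero.2 (Nat.factorial_ne_zero _)
end

section
/- Let p ≥ 2, n ≥ 1, let E be a real Banach space, and let s > 0. Consider the compact sets A := {x = (x_1, …, x_p) ∈ ℝ^p : Σ_{i=2}^p x_i² ≤ x_1²/9 and |x_1| ≤ s}, A⁺ := {x ∈ A : x_1 ≥ 0}, and A⁻ := {x ∈ A : x_1 ≤ 0}. Suppose Ω ⊆ ℝ^p is an open set containing A and f ∈ C^n(Ω, E) satisfies ∂^λ f(0, 0, …, 0) = 0 for every multi-index λ with |λ| ≤ n. Then there exists a function f₊ ∈ C^n(Ω, E) with compact support such that, for every multi-index λ with |λ| ≤ n, ∂^λ f₊(x) = ∂^λ f(x) for every x ∈ A⁺ and ∂^λ f₊(x) = 0 for every x ∈ A⁻. -/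
open Set Filter Topology

/-- The partial derivative of `f` with respect to the `i`-th coordinate. -/
noncomputable def partialD {p : ℕ} {E : Type*} [NormedAddCommGroup E] [NormedSpace ℝ E]
    (i : Fin p) (f : (Fin p → ℝ) → E) : (Fin p → ℝ) → E :=
  fun x => fderiv ℝ f x (Pi.single i 1)

/-- The iterated partial derivative `∂^λ f` associated with a multi-index `λ`. -/
noncomputable def pdMulti {p : ℕ} {E : Type*} [NormedAddCommGroup E] [NormedSpace ℝ E]
    (lam : Fin p → ℕ) (f : (Fin p → ℝ) → E) : (Fin p → ℝ) → E :=
  (List.finRange p).foldr (fun i g => (partialD i)^[lam i] g) f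

/-- The compact cone `A = {x : Σ_{i≥2} x_i² ≤ x_1²/9, |x_1| ≤ s}`. -/
def coneA (p : ℕ) (hp : 0 < p) (s : ℝ) : Set (Fin p → ℝ) :=
  {x | (∑ i ∈ Finset.univ.erase (⟨0, hp⟩ : Fin p), x i ^ 2) ≤ x ⟨0, hp⟩ ^ 2 / 9 ∧
    |x ⟨0, hp⟩| ≤ s}

/-- `A⁺ = {x ∈ A : x_1 ≥ 0}`. -/
def coneAplus (p : ℕ) (hp : 0 < p) (s : ℝ) : Set (Fin p → ℝ) :=
  {x ∈ coneA p hp s | 0 ≤ x ⟨0, hp⟩}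

/-- `A⁻ = {x ∈ A : x_1 ≤ 0}`. -/
def coneAminus (p : ℕ) (hp : 0 < p) (s : ℝ) : Set (Fin p → ℝ) :=
  {x ∈ coneA p hp s | x ⟨0, hp⟩ ≤ 0}

section PartialDerivatives

variable {p : ℕ} {E : Type*} [NormedAddCommGroup E] [NormedSpace ℝ E]

theorem Filter.EventuallyEq.partialD {f g : (Fin p → ℝ) → E} {x : Fin p → ℝ}
    (h : f =ᶠ[𝓝 x] g) (i : Fin p) : partialD i f =ᶠ[𝓝 x] partialD i g :=
  (h.fderiv (𝕜 := ℝ)).mono fun y hy => by simp only [_root_.partialD, hy]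

/-- The composition of the partial derivatives along the directions in the list `L`. -/
noncomputable def iterPartialD (L : List (Fin p)) (f : (Fin p → ℝ) → E) : (Fin p → ℝ) → E :=
  L.foldr partialD f

theorem Filter.EventuallyEq.iterPartialD {f g : (Fin p → ℝ) → E} {x : Fin p → ℝ}
    (h : f =ᶠ[𝓝 x] g) (L : List (Fin p)) : iterPartialD L f =ᶠ[𝓝 x] iterPartialD L g := by
  induction L with
  | nil => exact h
  | cons i L ih => exact ih.partialD i

theorem iterPartialD_zero (L : List (Fin p)) :
    iterPartialD L (0 : (Fin p → ℝ) → E) = 0 := by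
  induction L with
  | nil => rfl
  | cons i L ih =>
    change partialD i (iterPartialD L 0) = 0
    ext x
    simp [ih, partialD]

/-- The list of directions that contains each `i` exactly `lam i` times, in increasing order. -/
def directions (lam : Fin p → ℕ) : List (Fin p) :=
  (List.finRange p).flatMap fun i => List.replicate (lam i) i

theorem pdMulti_eq_iterPartialD (lam : Fin p → ℕ) (f : (Fin p → ℝ) → E) :
    pdMulti lam f = iterPartialD (directions lam) f := by
  unfold pdMulti iterPartialD directions
  induction List.finRange p with
  | nil => rfl
  | cons i L ih =>
    rw [List.foldr_cons, ih, List.flatMap_cons, List.foldr_append]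
    generalize List.foldr _ f (List.flatMap _ L) = g
    induction lam i with
    | zero => rfl
    | succ k ihk => rw [Function.iterate_succ_apply', ihk, List.replicate_succ, List.foldr_cons]

theorem length_directions (lam : Fin p → ℕ) : (directions lam).length = ∑ i, lam i := by
  simp [directions, List.length_flatMap, Fin.sum_univ_def]

theorem count_directions (lam : Fin p → ℕ) (i : Fin p) : (directions lam).count i = lam i := by
  simp only [directions, List.count_flatMap, Function.comp_def, List.count_replicate]
  rw [← Fin.sum_univ_def]
  simp

theorem ContDiff.partialD {k : ℕ} {f : (Fin p → ℝ) → E} (hf : ContDiff ℝ (k + 1 : ℕ) f)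
    (i : Fin p) : ContDiff ℝ k (partialD i f) :=
  (hf.fderiv_right (m := k) (by simp)).clm_apply contDiff_const

theorem ContDiff.iterPartialD {k : ℕ} {f : (Fin p → ℝ) → E} {L : List (Fin p)}
    (hf : ContDiff ℝ (k + L.length : ℕ) f) : ContDiff ℝ k (iterPartialD L f) := by
  induction L generalizing k with
  | nil => exact hf
  | cons i L ih =>
    refine ContDiff.partialD (ih ?_) i
    rwa [List.length_cons, add_comm L.length, ← add_assoc] at hf

theorem partialD_comm {f : (Fin p → ℝ) → E} (hf : ContDiff ℝ 2 f) (i j : Fin p) :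
    partialD i (partialD j f) = partialD j (partialD i f) := by
  ext x
  have hd : DifferentiableAt ℝ (fderiv ℝ f) x :=
    (hf.fderiv_right (m := 1) (by norm_num)).differentiable one_ne_zero x
  have key (i j : Fin p) : partialD i (partialD j f) x
      = fderiv ℝ (fderiv ℝ f) x (Pi.single i 1) (Pi.single j 1) := by
    have := (hd.hasFDerivAt.clm_apply (hasFDerivAt_const (Pi.single j (1 : ℝ)) x)).fderiv
    change fderiv ℝ (fun y => fderiv ℝ f y (Pi.single j 1)) x (Pi.single i 1) = _
    rw [this]
    simp
  rw [key, key]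
  exact (hf.contDiffAt.isSymmSndFDerivAt (by simp)) _ _

theorem iterPartialD_perm {f : (Fin p → ℝ) → E} {L L' : List (Fin p)} (h : L.Perm L')
    (hf : ContDiff ℝ (L.length : ℕ) f) : iterPartialD L f = iterPartialD L' f := by
  induction h with
  | nil => rfl
  | cons i _ ih =>
    exact congrArg (partialD i) (ih (hf.of_le (by simp)))
  | swap i j L =>
    refine partialD_comm (ContDiff.iterPartialD (k := 2) (hf.of_le ?_)) j i
    simp only [List.length_cons]
    exact_mod_cast (by omega : 2 + L.length ≤ L.length + 1 + 1)
  | trans h₁ _ ih₁ ih₂ =>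
    rw [ih₁ hf, ih₂ (by rwa [← h₁.length_eq])]

theorem iterPartialD_eq_pdMulti {f : (Fin p → ℝ) → E} {L : List (Fin p)}
    (hf : ContDiff ℝ (L.length : ℕ) f) :
    iterPartialD L f = pdMulti (fun i => L.count i) f := by
  rw [pdMulti_eq_iterPartialD]
  exact iterPartialD_perm (List.perm_iff_count.2 fun i => by rw [count_directions]) hf

theorem fderiv_apply_eq_sum_partialD (f : (Fin p → ℝ) → E) (x v : Fin p → ℝ) :
    fderiv ℝ f x v = ∑ i, v i • partialD i f x := by
  conv_lhs => rw [pi_eq_sum_univ' v]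
  simp [partialD, map_sum]

theorem norm_fderiv_le_sum_norm_partialD (f : (Fin p → ℝ) → E) (x : Fin p → ℝ) :
    ‖fderiv ℝ f x‖ ≤ ∑ i, ‖partialD i f x‖ := by
  refine ContinuousLinearMap.opNorm_le_bound _ (by positivity) fun v => ?_
  rw [fderiv_apply_eq_sum_partialD, Finset.sum_mul]
  refine norm_sum_le_of_le _ fun i _ => ?_
  rw [norm_smul, mul_comm]
  gcongr
  exact norm_le_pi_norm v i

/-- A function of class `C^k` all of whose partial derivatives of order at most `k` vanish at the
origin. -/
def IsFlat : ℕ → ((Fin p → ℝ) → E) → Prop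
  | 0, f => Continuous f ∧ f 0 = 0
  | k + 1, f => Differentiable ℝ f ∧ f 0 = 0 ∧ ∀ i, IsFlat k (partialD i f)

namespace IsFlat

variable {f g : (Fin p → ℝ) → E} {k : ℕ}

theorem apply_zero (hf : IsFlat k f) : f 0 = 0 := by
  cases k with
  | zero => exact hf.2
  | succ k => exact hf.2.1

theorem continuous (hf : IsFlat k f) : Continuous f := by
  cases k with
  | zero => exact hf.1
  | succ k => exact hf.1.continuous

theorem contDiff (hf : IsFlat k f) : ContDiff ℝ k f := by
  induction k generalizing f with
  | zero => exact contDiff_zero.2 hf.1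
  | succ k ih =>
    push_cast
    refine contDiff_succ_iff_fderiv_apply.2 ⟨hf.1, by simp, fun v => ?_⟩
    simp only [fderiv_apply_eq_sum_partialD]
    exact ContDiff.sum fun i _ => (ih (hf.2.2 i)).const_smul (v i)

theorem add (hf : IsFlat k f) (hg : IsFlat k g) : IsFlat k (f + g) := by
  induction k generalizing f g with
  | zero => exact ⟨hf.1.add hg.1, by simp [hf.2, hg.2]⟩
  | succ k ih =>
    refine ⟨hf.1.add hg.1, by simp [hf.2.1, hg.2.1], fun i => ?_⟩
    have : partialD i (f + g) = partialD i f + partialD i g := by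
      ext x
      simp [partialD, fderiv_add (hf.1 x) (hg.1 x)]
    rw [this]
    exact ih (hf.2.2 i) (hg.2.2 i)

theorem iterPartialD_apply_zero (hf : IsFlat k f) {L : List (Fin p)} (hL : L.length ≤ k) :
    iterPartialD L f 0 = 0 := by
  have key : ∀ L : List (Fin p), L.length ≤ k → IsFlat (k - L.length) (iterPartialD L f) := by
    intro L
    induction L with
    | nil => exact fun _ => hf
    | cons i L ih =>
      intro hL
      rw [List.length_cons] at hL ⊢
      have h := ih (by omega)
      rw [show k - L.length = k - (L.length + 1) + 1 by omega] at h
      exact h.2.2 i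
  exact (key L hL).apply_zero

theorem of_iterPartialD (hf : ContDiff ℝ k f)
    (h : ∀ L : List (Fin p), L.length ≤ k → iterPartialD L f 0 = 0) : IsFlat k f := by
  induction k generalizing f with
  | zero => exact ⟨hf.continuous, h [] le_rfl⟩
  | succ k ih =>
    refine ⟨hf.differentiable (by simp), h [] (by simp), fun i => ?_⟩
    refine ih (hf.partialD i) fun L hL => ?_
    simpa [iterPartialD] using h (L ++ [i]) (by simpa using hL)

theorem of_pdMulti (hf : ContDiff ℝ k f)
    (h : ∀ lam : Fin p → ℕ, (∑ i, lam i) ≤ k → pdMulti lam f 0 = 0) : IsFlat k f := by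
  refine of_iterPartialD hf fun L hL => ?_
  rw [iterPartialD_eq_pdMulti (hf.of_le (by exact_mod_cast hL))]
  refine h _ (le_trans (le_of_eq ?_) hL)
  simpa using Multiset.sum_count_eq_card (s := Finset.univ) (m := (L : Multiset (Fin p)))

theorem isLittleO (hf : IsFlat k f) : f =o[𝓝 0] fun x => ‖x‖ ^ k := by
  induction k generalizing f with
  | zero =>
    simp only [pow_zero, Asymptotics.isLittleO_one_iff]
    simpa [hf.2] using hf.1.tendsto 0
  | succ k ih =>
    have h : (fun x => fderiv ℝ f x) =o[𝓝 0] fun x => ‖x‖ ^ k := by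
      refine Asymptotics.IsBigO.trans_isLittleO (.of_bound 1 (.of_forall fun x => ?_))
        (Asymptotics.IsLittleO.sum fun i (_ : i ∈ Finset.univ) => (ih (hf.2.2 i)).norm_left)
      rw [one_mul, Finset.sum_apply, Real.norm_of_nonneg (by positivity)]
      exact norm_fderiv_le_sum_norm_partialD f x
    rw [Asymptotics.isLittleO_iff] at h ⊢
    intro c hc
    obtain ⟨ε, hε, hb⟩ := Metric.eventually_nhds_iff_ball.1 (h hc)
    filter_upwards [Metric.ball_mem_nhds 0 hε] with x hx
    rw [mem_ball_zero_iff] at hx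
    have := Convex.norm_image_sub_le_of_norm_fderiv_le (𝕜 := ℝ) (f := f) (C := c * ‖x‖ ^ k)
      (s := Metric.closedBall 0 ‖x‖) (x := 0) (y := x) (fun y _ => hf.1 y) (fun y hy => ?_)
      (convex_closedBall _ _) (by simp) (by simp)
    · simpa [hf.2.1, pow_succ, mul_assoc] using this
    · rw [mem_closedBall_zero_iff] at hy
      refine (hb y (by simpa using hy.trans_lt hx)).trans ?_
      rw [Real.norm_of_nonneg (by positivity)]
      gcongr

end IsFlat

end PartialDerivatives

section Homogeneous

open scoped ContDiff

variable {p : ℕ} {E : Type*} [NormedAddCommGroup E] [NormedSpace ℝ E]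

/-- A real function that is smooth and positively homogeneous of degree `-m` away from the
origin. -/
structure IsSmoothHomogeneous (m : ℕ) (ψ : (Fin p → ℝ) → ℝ) : Prop where
  contDiffAt : ∀ x ≠ 0, ContDiffAt ℝ ∞ ψ x
  pow_mul_smul : ∀ t : ℝ, 0 < t → ∀ x ≠ 0, t ^ m * ψ (t • x) = ψ x

namespace IsSmoothHomogeneous

variable {m k : ℕ} {ψ : (Fin p → ℝ) → ℝ} {f : (Fin p → ℝ) → E}

theorem differentiableAt (hψ : IsSmoothHomogeneous m ψ) {x : Fin p → ℝ} (hx : x ≠ 0) :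
    DifferentiableAt ℝ ψ x :=
  (hψ.contDiffAt x hx).differentiableAt (by simp)

theorem exists_norm_mul_norm_pow_le (hψ : IsSmoothHomogeneous m ψ) :
    ∃ C : ℝ, 0 < C ∧ ∀ x ≠ 0, ‖ψ x‖ * ‖x‖ ^ m ≤ C := by
  have hc : ContinuousOn ψ (Metric.sphere 0 1) := fun x hx =>
    (hψ.contDiffAt x (ne_zero_of_mem_unit_sphere ⟨x, hx⟩)).continuousAt.continuousWithinAt
  obtain ⟨C, hC⟩ := (isCompact_sphere (0 : Fin p → ℝ) 1).exists_bound_of_continuousOn hc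
  refine ⟨max C 1, by positivity, fun x hx => le_max_of_le_left ?_⟩
  have hx' : 0 < ‖x‖ := norm_pos_iff.2 hx
  have hu : ‖x‖⁻¹ • x ∈ Metric.sphere (0 : Fin p → ℝ) 1 := by
    simp [norm_smul, hx'.ne']
  have h := hψ.pow_mul_smul ‖x‖ hx' (‖x‖⁻¹ • x) (by simp [hx])
  rw [smul_inv_smul₀ hx'.ne'] at h
  have := hC _ hu
  rwa [← h, norm_mul, norm_pow, norm_norm, mul_comm] at this

theorem partialD (hψ : IsSmoothHomogeneous m ψ) (i : Fin p) :
    IsSmoothHomogeneous (m + 1) (partialD i ψ) where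
  contDiffAt x hx :=
    ((hψ.contDiffAt x hx).fderiv_right (m := ∞) (by simp)).clm_apply contDiffAt_const
  pow_mul_smul t ht x hx := by
    have h : (fun y => t ^ m • ψ (t • y)) =ᶠ[𝓝 x] ψ := by
      filter_upwards [isOpen_ne.mem_nhds hx] with y hy
      exact hψ.pow_mul_smul t ht y hy
    have hd : DifferentiableAt ℝ (fun y => ψ (t • y)) x :=
      (hψ.differentiableAt (smul_ne_zero ht.ne' hx)).comp x (by fun_prop)
    have := congrArg (fun L : (Fin p → ℝ) →L[ℝ] ℝ => L (Pi.single i 1)) (h.fderiv_eq (𝕜 := ℝ))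
    simp only [fderiv_fun_const_smul hd, fderiv_comp_smul] at this
    simpa [_root_.partialD, pow_succ, mul_assoc] using this

theorem isLittleO_smul (hψ : IsSmoothHomogeneous m ψ) (hf : IsFlat (m + k) f) :
    (fun x => ψ x • f x) =o[𝓝 0] fun x => ‖x‖ ^ k := by
  obtain ⟨C, hC, hb⟩ := hψ.exists_norm_mul_norm_pow_le
  refine Asymptotics.isLittleO_iff.2 fun c hc => ?_
  filter_upwards [Asymptotics.isLittleO_iff.1 hf.isLittleO (div_pos hc hC)] with x hx
  rcases eq_or_ne x 0 with rfl | hx0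
  · rw [hf.apply_zero, smul_zero, norm_zero]
    positivity
  · rw [norm_smul]
    rw [norm_pow, norm_norm] at hx ⊢
    calc ‖ψ x‖ * ‖f x‖ ≤ ‖ψ x‖ * (c / C * ‖x‖ ^ (m + k)) := by gcongr
      _ = (‖ψ x‖ * ‖x‖ ^ m) * (c / C * ‖x‖ ^ k) := by ring
      _ ≤ C * (c / C * ‖x‖ ^ k) := by gcongr; exact hb x hx0
      _ = c * ‖x‖ ^ k := by field_simp

theorem isFlat_smul (hψ : IsSmoothHomogeneous m ψ) (hf : IsFlat (m + k) f) :
    IsFlat k (fun x => ψ x • f x) := by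
  induction k generalizing m ψ f with
  | zero =>
    refine ⟨continuous_iff_continuousAt.2 fun x => ?_, by simp [hf.apply_zero]⟩
    rcases eq_or_ne x 0 with rfl | hx
    · have h := hψ.isLittleO_smul hf
      simp only [pow_zero, Asymptotics.isLittleO_one_iff] at h
      simpa [ContinuousAt, hf.apply_zero] using h
    · exact (hψ.contDiffAt x hx).continuousAt.smul hf.continuous.continuousAt
  | succ k ih =>
    have hf' : Differentiable ℝ f ∧ f 0 = 0 ∧ ∀ i, IsFlat (m + k) (_root_.partialD i f) := hf
    have h0 : HasFDerivAt (fun x => ψ x • f x) (0 : (Fin p → ℝ) →L[ℝ] E) 0 := by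
      refine .of_isLittleO ?_
      simp only [hf'.2.1, smul_zero, sub_zero, zero_apply]
      refine (hψ.isLittleO_smul hf).trans_isBigO (.of_bound 1 ?_)
      filter_upwards [Metric.closedBall_mem_nhds 0 one_pos] with x hx
      rw [mem_closedBall_zero_iff] at hx
      rw [norm_pow, norm_norm, one_mul, pow_succ]
      exact mul_le_of_le_one_left (norm_nonneg x) (pow_le_one₀ (norm_nonneg x) hx)
    have h1 {x : Fin p → ℝ} (hx : x ≠ 0) :=
      (hψ.differentiableAt hx).hasFDerivAt.smul (hf'.1 x).hasFDerivAt
    refine ⟨fun x => ?_, by simp [hf'.2.1], fun i => ?_⟩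
    · rcases eq_or_ne x 0 with rfl | hx
      · exact h0.differentiableAt
      · exact (h1 hx).differentiableAt
    · have heq : _root_.partialD i (fun x => ψ x • f x) =
          (fun x => _root_.partialD i ψ x • f x) + fun x => ψ x • _root_.partialD i f x := by
        ext x
        rcases eq_or_ne x 0 with rfl | hx
        · rw [Pi.add_apply, (hf'.2.2 i).apply_zero, hf'.2.1, _root_.partialD, h0.fderiv]
          simp
        · have := (h1 hx).fderiv
          change fderiv ℝ (ψ • f) x (Pi.single i 1) = _
          rw [this]
          simp [_root_.partialD, add_comm]
      rw [heq]
      refine (ih (hψ.partialD i) ?_).add (ih hψ (hf'.2.2 i))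
      rwa [add_assoc, add_comm 1 k]

end IsSmoothHomogeneous

theorem sum_sq_pos {x : Fin p → ℝ} (hx : x ≠ 0) : 0 < ∑ i, x i ^ 2 := by
  obtain ⟨i, hi⟩ := Function.ne_iff.1 hx
  exact Finset.sum_pos' (fun _ _ => sq_nonneg _) ⟨i, Finset.mem_univ i, sq_pos_of_ne_zero hi⟩

/-- A function of the angle between `x` and the `i`-th coordinate axis, equal to `1` on a cone
around the positive half-axis and to `0` on the opposite cone. -/
noncomputable def coneCutoff (i : Fin p) (x : Fin p → ℝ) : ℝ :=
  Real.smoothTransition (x i / √(∑ j, x j ^ 2) + 1 / 2)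

theorem isSmoothHomogeneous_coneCutoff (i : Fin p) : IsSmoothHomogeneous 0 (coneCutoff i) where
  contDiffAt x hx := by
    refine Real.smoothTransition.contDiffAt.comp x (.add (.div ?_ (.sqrt ?_ ?_) ?_) contDiffAt_const)
    · fun_prop
    · fun_prop
    · exact (sum_sq_pos hx).ne'
    · exact (Real.sqrt_pos.2 (sum_sq_pos hx)).ne'
  pow_mul_smul t ht x _ := by
    simp only [coneCutoff, Pi.smul_apply, smul_eq_mul, mul_pow, ← Finset.mul_sum, pow_zero, one_mul]
    rw [Real.sqrt_mul (by positivity), Real.sqrt_sq ht.le, mul_div_mul_left _ _ ht.ne']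

theorem continuousAt_div_sqrt_sum_sq (i : Fin p) {x : Fin p → ℝ} (hx : x ≠ 0) :
    ContinuousAt (fun y : Fin p → ℝ => y i / √(∑ j, y j ^ 2)) x :=
  (continuous_apply i).continuousAt.div
    (continuous_finsetSum _ fun j _ => (continuous_apply j).pow 2).sqrt.continuousAt
    (Real.sqrt_pos.2 (sum_sq_pos hx)).ne'

theorem coneCutoff_eventuallyEq_one (i : Fin p) {x : Fin p → ℝ} (hx : 0 < x i)
    (h : ∑ j, x j ^ 2 < 4 * x i ^ 2) : coneCutoff i =ᶠ[𝓝 x] 1 := by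
  have hx0 : x ≠ 0 := by rintro rfl; simp at hx
  have hlt : 1 / 2 < x i / √(∑ j, x j ^ 2) := by
    rw [lt_div_iff₀ (Real.sqrt_pos.2 (sum_sq_pos hx0))]
    have : √(∑ j, x j ^ 2) < 2 * x i := by
      rw [Real.sqrt_lt' (by positivity)]
      linarith
    linarith
  filter_upwards [(continuousAt_div_sqrt_sum_sq i hx0).eventually (lt_mem_nhds hlt)] with y hy
  exact Real.smoothTransition.one_of_one_le (by linarith)

theorem coneCutoff_eventuallyEq_zero (i : Fin p) {x : Fin p → ℝ} (hx : x i < 0)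
    (h : ∑ j, x j ^ 2 < 4 * x i ^ 2) : coneCutoff i =ᶠ[𝓝 x] 0 := by
  have hx0 : x ≠ 0 := by rintro rfl; simp at hx
  have hlt : x i / √(∑ j, x j ^ 2) < -(1 / 2) := by
    rw [div_lt_iff₀ (Real.sqrt_pos.2 (sum_sq_pos hx0))]
    have : √(∑ j, x j ^ 2) < 2 * (-x i) := by
      rw [Real.sqrt_lt' (by linarith)]
      linarith
    linarith
  filter_upwards [(continuousAt_div_sqrt_sum_sq i hx0).eventually (gt_mem_nhds hlt)] with y hy
  exact Real.smoothTransition.zero_of_nonpos (by linarith)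

end Homogeneous

section Cutoff

open scoped ContDiff Manifold

theorem exists_contDiff_hasCompactSupport_eq_one {V : Type*} [NormedAddCommGroup V]
    [NormedSpace ℝ V] [FiniteDimensional ℝ V] {K U : Set V} (hK : IsCompact K) (hU : IsOpen U)
    (hKU : K ⊆ U) : ∃ χ : V → ℝ, ContDiff ℝ ∞ χ ∧ HasCompactSupport χ ∧ tsupport χ ⊆ U ∧
      ∀ x ∈ K, χ =ᶠ[𝓝 x] 1 := by
  obtain ⟨L, hL, hKL, hLU⟩ := exists_compact_between hK hU hKU
  obtain ⟨χ, h1, h0, -⟩ :=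
    exists_contMDiffMap_one_nhds_of_subset_interior 𝓘(ℝ, V) (n := ⊤) hK.isClosed hKL
  have hsupp : Function.support χ ⊆ L := fun x hx => by_contra fun h => hx (h0 x h)
  exact ⟨χ, χ.contMDiff.contDiff, .of_support_subset_isCompact hL hsupp,
    (closure_minimal hsupp hL.isClosed).trans hLU, fun x hx => eventually_nhdsSet_iff_forall.1 h1 x hx⟩

theorem ContDiffOn.smul_of_tsupport_subset {V E : Type*} [NormedAddCommGroup V]
    [NormedSpace ℝ V] [NormedAddCommGroup E] [NormedSpace ℝ E] {n : ℕ∞ω} {U : Set V} {χ : V → ℝ}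
    {f : V → E} (hf : ContDiffOn ℝ n f U) (hU : IsOpen U) (hχ : ContDiff ℝ n χ)
    (hχU : tsupport χ ⊆ U) : ContDiff ℝ n fun x => χ x • f x := by
  refine contDiff_iff_contDiffAt.2 fun x => ?_
  by_cases hx : x ∈ tsupport χ
  · exact hχ.contDiffAt.smul (hf.contDiffAt (hU.mem_nhds (hχU hx)))
  · refine (contDiffAt_const (c := (0 : E))).congr_of_eventuallyEq ?_
    filter_upwards [notMem_tsupport_iff_eventuallyEq.1 hx] with y hy
    simp [hy]

end Cutoff

section Cone

variable {p : ℕ} {hp : 0 < p} {s : ℝ} {x : Fin p → ℝ}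

theorem sum_sq_le_of_mem_coneA (hx : x ∈ coneA p hp s) :
    ∑ i, x i ^ 2 ≤ 10 / 9 * x ⟨0, hp⟩ ^ 2 := by
  rw [← Finset.add_sum_erase _ _ (Finset.mem_univ (⟨0, hp⟩ : Fin p))]
  linarith [hx.1]

theorem apply_zero_ne_zero_of_mem_coneA (hx : x ∈ coneA p hp s) (hx0 : x ≠ 0) :
    x ⟨0, hp⟩ ≠ 0 := fun h => by
  have := sum_sq_le_of_mem_coneA hx
  rw [h] at this
  linarith [sum_sq_pos hx0]

theorem zero_mem_coneA (hs : 0 ≤ s) : 0 ∈ coneA p hp s := by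
  simp [coneA, hs]

theorem isCompact_coneA : IsCompact (coneA p hp s) := by
  refine Metric.isCompact_of_isClosed_isBounded ?_ ?_
  · have h (i : Fin p) : Continuous fun x : Fin p → ℝ => x i := continuous_apply i
    exact (isClosed_le (continuous_finsetSum _ fun i _ => (h i).pow 2)
      (((h ⟨0, hp⟩).pow 2).div_const 9)).inter (isClosed_le (h ⟨0, hp⟩).abs continuous_const)
  · refine (Metric.isBounded_closedBall (x := 0) (r := 2 * |s|)).subset fun x hx => ?_
    rw [mem_closedBall_zero_iff, pi_norm_le_iff_of_nonneg (by positivity)]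
    intro i
    have h1 : x i ^ 2 ≤ ∑ i, x i ^ 2 :=
      Finset.single_le_sum (f := fun i => x i ^ 2) (fun _ _ => sq_nonneg _) (Finset.mem_univ i)
    have h2 : x ⟨0, hp⟩ ^ 2 ≤ s ^ 2 := sq_le_sq.2 (hx.2.trans (le_abs_self s))
    refine abs_le_of_sq_le_sq ?_ (by positivity)
    rw [mul_pow, sq_abs]
    nlinarith [sum_sq_le_of_mem_coneA hx, sq_nonneg s]

end Cone

/-- a one-sided Whitney-type cut-off along the cone `A`. -/
theorem one_sided_extension {p n : ℕ} {E : Type*} [NormedAddCommGroup E]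
    [NormedSpace ℝ E] [CompleteSpace E] (hp : 2 ≤ p) (hn : 1 ≤ n) (s : ℝ) (hs : 0 < s)
    {Ω : Set (Fin p → ℝ)} (hΩ : IsOpen Ω)
    (hAΩ : coneA p (by omega) s ⊆ Ω)
    (f : (Fin p → ℝ) → E) (hf : ContDiffOn ℝ n f Ω)
    (hf0 : ∀ lam : Fin p → ℕ, (∑ i, lam i) ≤ n → pdMulti lam f 0 = 0) :
    ∃ fplus : (Fin p → ℝ) → E, ContDiffOn ℝ n fplus Ω ∧ HasCompactSupport fplus ∧
      tsupport fplus ⊆ Ω ∧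
      ∀ lam : Fin p → ℕ, (∑ i, lam i) ≤ n →
        (∀ x ∈ coneAplus p (by omega) s, pdMulti lam fplus x = pdMulti lam f x) ∧
        (∀ x ∈ coneAminus p (by omega) s, pdMulti lam fplus x = 0) := by
  obtain ⟨χ, hχ, hχc, hχΩ, hχ1⟩ := exists_contDiff_hasCompactSupport_eq_one isCompact_coneA hΩ hAΩ
  set i₀ : Fin p := ⟨0, by omega⟩
  have h0A : (0 : Fin p → ℝ) ∈ coneA p (by omega) s := zero_mem_coneA hs.le
  have hχf {x : Fin p → ℝ} (hx : x ∈ coneA p (by omega) s) : (fun x => χ x • f x) =ᶠ[𝓝 x] f := by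
    filter_upwards [hχ1 x hx] with y hy
    simp [hy]
  have hflat : IsFlat n fun x => χ x • f x := by
    refine .of_pdMulti (hf.smul_of_tsupport_subset hΩ (contDiff_infty.1 hχ n) hχΩ) fun lam hlam => ?_
    rw [pdMulti_eq_iterPartialD, ((hχf h0A).iterPartialD _).eq_of_nhds, ← pdMulti_eq_iterPartialD]
    exact hf0 lam hlam
  have hplus : IsFlat n fun x => coneCutoff i₀ x • χ x • f x :=
    (isSmoothHomogeneous_coneCutoff i₀).isFlat_smul (by rwa [zero_add])
  have hsub : tsupport (fun x => coneCutoff i₀ x • χ x • f x) ⊆ tsupport χ :=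
    (tsupport_smul_subset_right _ _).trans (tsupport_smul_subset_left _ _)
  have hplus0 {lam : Fin p → ℕ} (hlam : ∑ i, lam i ≤ n) :
      pdMulti lam (fun x => coneCutoff i₀ x • χ x • f x) 0 = 0 := by
    rw [pdMulti_eq_iterPartialD]
    exact hplus.iterPartialD_apply_zero (by rwa [length_directions])
  have hcone {x : Fin p → ℝ} (hx : x ∈ coneA p (by omega) s) (hx0 : x ≠ 0) :
      ∑ j, x j ^ 2 < 4 * x i₀ ^ 2 := by
    have := sum_sq_le_of_mem_coneA hx
    have := sq_pos_of_ne_zero (apply_zero_ne_zero_of_mem_coneA hx hx0)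
    linarith
  refine ⟨_, hplus.contDiff.contDiffOn, hχc.of_isClosed_subset (isClosed_tsupport _) hsub,
    hsub.trans hχΩ, fun lam hlam => ⟨fun x hx => ?_, fun x hx => ?_⟩⟩
  · rcases eq_or_ne x 0 with rfl | hx0
    · rw [hplus0 hlam, hf0 lam hlam]
    · have h1 := coneCutoff_eventuallyEq_one i₀
        (lt_of_le_of_ne hx.2 (apply_zero_ne_zero_of_mem_coneA hx.1 hx0).symm) (hcone hx.1 hx0)
      have h : (fun x => coneCutoff i₀ x • χ x • f x) =ᶠ[𝓝 x] f := by
        filter_upwards [h1, hχf hx.1] with y hy hy'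
        simp [hy, hy']
      simp only [pdMulti_eq_iterPartialD, (h.iterPartialD _).eq_of_nhds]
  · rcases eq_or_ne x 0 with rfl | hx0
    · exact hplus0 hlam
    · have h1 := coneCutoff_eventuallyEq_zero i₀
        (lt_of_le_of_ne hx.2 (apply_zero_ne_zero_of_mem_coneA hx.1 hx0)) (hcone hx.1 hx0)
      have h : (fun x => coneCutoff i₀ x • χ x • f x) =ᶠ[𝓝 x] 0 := by
        filter_upwards [h1] with y hy
        simp [hy]
      rw [pdMulti_eq_iterPartialD, (h.iterPartialD _).eq_of_nhds, iterPartialD_zero, Pi.zero_apply]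
end

section
/- Let E be a real Banach space, let Ω ⊆ ℝ^p be a nonempty open set, let n ≥ 1, let f ∈ C^n(Ω, E), let a ∈ Ω and r > 0 be such that the closed ball {x : |x − a| ≤ r} (with |x| = max_j |x_j|) is contained in Ω, and let T_a be the Taylor polynomial function of degree n of f at a. Then for every i ∈ {0, 1, …, n} and every b with |b − a| < r, ‖D^i T_a(b) − D^i f(b)‖ ≤ (|b − a|^{n−i}/(n−i)!) · sup_{|x − a| ≤ r} ‖D^n f(x) − D^n f(a)‖. -/
open Set Filter Topology

/-- The iterated derivatives of a `C^n` function over the reals are symmetric. -/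
theorem ContDiffAt.iteratedFDeriv_comp_perm_of_real {V F : Type*}
    [NormedAddCommGroup V] [NormedSpace ℝ V] [NormedAddCommGroup F] [NormedSpace ℝ F]
    {f : V → F} {k : ℕ} {x : V} (hf : ContDiffAt ℝ k f x) (v : Fin k → V)
    (σ : Equiv.Perm (Fin k)) :
    iteratedFDeriv ℝ k f x (v ∘ σ) = iteratedFDeriv ℝ k f x v := by
  induction k generalizing x with
  | zero => rw [Subsingleton.elim (v ∘ σ) v]
  | succ k ih =>
    have h_swap : ∀ (i : Fin k) (v : Fin (k + 1) → V),
        iteratedFDeriv ℝ (k + 1) f x (v ∘ Equiv.swap i.castSucc i.succ) =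
          iteratedFDeriv ℝ (k + 1) f x v := by
      intro i v
      cases k with
      | zero => exact i.elim0
      | succ k =>
        have hd : DifferentiableAt ℝ (iteratedFDeriv ℝ (k + 1) f) x :=
          hf.differentiableAt_iteratedFDeriv (by norm_cast; omega)
        induction i using Fin.cases with
        | zero =>
          have hf₂ : ContDiffAt ℝ 2 (iteratedFDeriv ℝ k f) x :=
            hf.iteratedFDeriv_right (by norm_cast; omega)
          have hd₂ : DifferentiableAt ℝ (fderiv ℝ (iteratedFDeriv ℝ k f)) x :=
            (hf₂.fderiv_right (m := 1) (by norm_num)).differentiableAt one_ne_zero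
          have h_symm : IsSymmSndFDerivAt ℝ (iteratedFDeriv ℝ k f) x :=
            hf₂.isSymmSndFDerivAt (by simp)
          have key : ∀ w : Fin (k + 2) → V, iteratedFDeriv ℝ (k + 1 + 1) f x w =
              fderiv ℝ (fderiv ℝ (iteratedFDeriv ℝ k f)) x (w 0) (w 1)
                (Fin.tail (Fin.tail w)) := by
            intro w
            rw [hd.iteratedFDeriv_succ_apply_left']
            change fderiv ℝ (fun y ↦ fderiv ℝ (iteratedFDeriv ℝ k f) y (w 1)
              (Fin.tail (Fin.tail w))) x (w 0) = _
            rw [fderiv_continuousMultilinear_apply_const_apply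
              (hd₂.clm_apply (differentiableAt_const _)),
              fderiv_clm_apply hd₂ (differentiableAt_const _)]
            simp
          rw [key, key, h_symm.eq]
          have h_tail : Fin.tail (Fin.tail (v ∘ Equiv.swap (0 : Fin (k + 1)).castSucc
              (0 : Fin (k + 1)).succ)) = Fin.tail (Fin.tail v) := by
            funext j
            simp only [Fin.tail, Function.comp_apply]
            rw [Equiv.swap_apply_of_ne_of_ne] <;> simp [Fin.ext_iff]
          rw [h_tail]
          simp
        | succ j =>
          rw [hd.iteratedFDeriv_succ_apply_left', hd.iteratedFDeriv_succ_apply_left']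
          have h_zero : (v ∘ Equiv.swap j.succ.castSucc j.succ.succ) 0 = v 0 := by
            simp only [Function.comp_apply]
            rw [Equiv.swap_apply_of_ne_of_ne] <;> simp [Fin.ext_iff]
          have h_tail : Fin.tail (v ∘ Equiv.swap j.succ.castSucc j.succ.succ) =
              Fin.tail v ∘ Equiv.swap j.castSucc j.succ := by
            funext l
            simp only [Fin.tail, Function.comp_apply, ← Fin.succ_castSucc]
            rw [(Fin.succ_injective _).map_swap]
          rw [h_zero, h_tail]
          congr 1
          apply Filter.EventuallyEq.fderiv_eq
          filter_upwards [(hf.of_le (m := (k + 1 : ℕ)) (by norm_cast; omega)).eventually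
            (by simp)] with y hy
          exact ih hy _ _
    have hσ : σ ∈ Submonoid.closure
        (Set.range fun i : Fin k ↦ Equiv.swap i.castSucc i.succ) := by
      rw [Equiv.Perm.mclosure_swap_castSucc_succ]
      trivial
    induction hσ using Submonoid.closure_induction generalizing v with
    | mem τ hτ =>
      obtain ⟨i, rfl⟩ := hτ
      exact h_swap i v
    | one => rfl
    | mul τ₁ τ₂ _ _ h₁ h₂ =>
      rw [Equiv.Perm.coe_mul, ← Function.comp_assoc, h₂, h₁]

/-- If a function has a finite power series, then so do its iterated derivatives. -/
theorem HasFiniteFPowerSeriesOnBall.iteratedFDeriv {𝕜 V F : Type*} [NontriviallyNormedField 𝕜]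
    [NormedAddCommGroup V] [NormedSpace 𝕜 V] [NormedAddCommGroup F] [NormedSpace 𝕜 F]
    {f : V → F} {q : FormalMultilinearSeries 𝕜 V F} {x : V} {r : ENNReal} {m k : ℕ}
    (h : HasFiniteFPowerSeriesOnBall f q x (m + k) r) :
    HasFiniteFPowerSeriesOnBall (iteratedFDeriv 𝕜 k f) (q.iteratedFDerivSeries k) x m r := by
  induction k generalizing m with
  | zero =>
    exact (continuousMultilinearCurryFin0 𝕜 V F).symm
      |>.toContinuousLinearEquiv.toContinuousLinearMap.comp_hasFiniteFPowerSeriesOnBall h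
  | succ k ih =>
    have h' : HasFiniteFPowerSeriesOnBall f q x (m + 1 + k) r := by
      rwa [add_right_comm, add_assoc]
    rw [iteratedFDeriv_succ_eq_comp_left]
    exact (continuousMultilinearCurryLeftEquiv 𝕜 (fun _ : Fin (k + 1) ↦ V) F).symm
      |>.toContinuousLinearEquiv.toContinuousLinearMap.comp_hasFiniteFPowerSeriesOnBall
        (ih h').fderiv

/-- If the derivatives of order `< n` of `g` vanish at the center of a ball on which the
`n`-th derivative is bounded, then the lower order derivatives satisfy Taylor-type bounds. -/
theorem norm_iteratedFDeriv_le_of_eq_zero_at_center {V F : Type*}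
    [NormedAddCommGroup V] [NormedSpace ℝ V] [NormedAddCommGroup F] [NormedSpace ℝ F]
    {g : V → F} {a : V} {r M : ℝ} {n : ℕ}
    (hg : ∀ x ∈ Metric.ball a r, ContDiffAt ℝ n g x)
    (h₀ : ∀ k < n, iteratedFDeriv ℝ k g a = 0)
    (hM : ∀ x ∈ Metric.ball a r, ‖iteratedFDeriv ℝ n g x‖ ≤ M)
    {i j : ℕ} (hij : i + j = n) {x : V} (hx : x ∈ Metric.ball a r) :
    ‖iteratedFDeriv ℝ i g x‖ ≤ ‖x - a‖ ^ j / (j.factorial : ℝ) * M := by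
  induction j generalizing i x with
  | zero =>
    obtain rfl : i = n := by omega
    simpa using hM x hx
  | succ j ih =>
    have h_norm : ∀ t ∈ Icc (0 : ℝ) 1, ‖t • (x - a)‖ = t * ‖x - a‖ := fun t ht ↦ by
      rw [norm_smul, Real.norm_of_nonneg ht.1]
    have h_mem : ∀ t ∈ Icc (0 : ℝ) 1, a + t • (x - a) ∈ Metric.ball a r := by
      intro t ht
      rw [mem_ball_iff_norm] at hx ⊢
      rw [add_sub_cancel_left, h_norm t ht]
      exact (mul_le_of_le_one_left (norm_nonneg _) ht.2).trans_lt hx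
    have h_deriv : ∀ t ∈ Icc (0 : ℝ) 1,
        HasDerivAt (fun s : ℝ ↦ iteratedFDeriv ℝ i g (a + s • (x - a)))
          (fderiv ℝ (iteratedFDeriv ℝ i g) (a + t • (x - a)) (x - a)) t := by
      intro t ht
      have hd : DifferentiableAt ℝ (iteratedFDeriv ℝ i g) (a + t • (x - a)) :=
        (hg _ (h_mem t ht)).differentiableAt_iteratedFDeriv (by norm_cast; omega)
      have hl : HasDerivAt (fun s : ℝ ↦ a + s • (x - a)) (x - a) t := by
        simpa using ((hasDerivAt_id t).smul_const (x - a)).const_add a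
      exact hd.hasFDerivAt.comp_hasDerivAt t hl
    have h_bound := image_norm_le_of_norm_deriv_right_le_deriv_boundary (a := 0) (b := 1)
      (B := fun t : ℝ ↦ t ^ (j + 1) * (‖x - a‖ ^ (j + 1) / ((j + 1).factorial : ℝ) * M))
      (B' := fun t : ℝ ↦ ((j + 1 : ℕ) : ℝ) * t ^ j *
        (‖x - a‖ ^ (j + 1) / ((j + 1).factorial : ℝ) * M))
      (fun t ht ↦ (h_deriv t ht).continuousAt.continuousWithinAt)
      (fun t ht ↦ (h_deriv t (Ico_subset_Icc_self ht)).hasDerivWithinAt)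
      (by simp [h₀ i (by omega)])
      (fun t ↦ by simpa using (hasDerivAt_pow (j + 1) t).mul_const _)
      (by
        intro t ht
        have ht' := Ico_subset_Icc_self ht
        calc ‖fderiv ℝ (iteratedFDeriv ℝ i g) (a + t • (x - a)) (x - a)‖
            ≤ ‖iteratedFDeriv ℝ (i + 1) g (a + t • (x - a))‖ * ‖x - a‖ := by
              rw [← norm_fderiv_iteratedFDeriv]
              exact ContinuousLinearMap.le_opNorm _ _
          _ ≤ ((t * ‖x - a‖) ^ j / (j.factorial : ℝ) * M) * ‖x - a‖ := by
              gcongr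
              simpa [h_norm t ht'] using ih (by omega) (h_mem t ht')
          _ = ((j + 1 : ℕ) : ℝ) * t ^ j *
                (‖x - a‖ ^ (j + 1) / ((j + 1).factorial : ℝ) * M) := by
              rw [Nat.factorial_succ]
              push_cast
              field_simp
              ring)
    simpa using h_bound (right_mem_Icc.2 zero_le_one)

/-- The Taylor polynomial of degree `n` of a function at `a`, as a formal power series. -/
noncomputable def taylorPolynomialSeries {V F : Type*}
    [NormedAddCommGroup V] [NormedSpace ℝ V] [NormedAddCommGroup F] [NormedSpace ℝ F]
    (f : V → F) (n : ℕ) (a : V) : FormalMultilinearSeries ℝ V F :=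
  fun k ↦ if k ≤ n then ((k.factorial : ℝ))⁻¹ • iteratedFDeriv ℝ k f a else 0

theorem hasFiniteFPowerSeriesOnBall_taylorPolynomialSeries {V F : Type*}
    [NormedAddCommGroup V] [NormedSpace ℝ V] [NormedAddCommGroup F] [NormedSpace ℝ F]
    (f : V → F) (n : ℕ) (a : V) :
    HasFiniteFPowerSeriesOnBall
      (fun z => ∑ k ∈ Finset.range (n + 1),
        ((k.factorial : ℝ))⁻¹ • iteratedFDeriv ℝ k f a (fun _ => z - a))
      (taylorPolynomialSeries f n a) a (n + 1) ⊤ := by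
  refine .mk' (fun m hm ↦ if_neg (by omega)) (by simp) fun y _ ↦ ?_
  refine Finset.sum_congr rfl fun k hk ↦ ?_
  rw [taylorPolynomialSeries, if_pos (Finset.mem_range_succ_iff.1 hk)]
  simp

/-- The derivatives of the Taylor polynomial at the base point are those of the function. -/
theorem iteratedFDeriv_taylorPolynomial_self {V F : Type*}
    [NormedAddCommGroup V] [NormedSpace ℝ V] [NormedAddCommGroup F] [NormedSpace ℝ F]
    [CompleteSpace F] {f : V → F} {n k : ℕ} {a : V} (hf : ContDiffAt ℝ n f a) (hk : k ≤ n) :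
    iteratedFDeriv ℝ k
      (fun z => ∑ k ∈ Finset.range (n + 1),
        ((k.factorial : ℝ))⁻¹ • iteratedFDeriv ℝ k f a (fun _ => z - a)) a =
      iteratedFDeriv ℝ k f a := by
  ext v
  have h_perm (σ : Equiv.Perm (Fin k)) :
      iteratedFDeriv ℝ k f a (fun i ↦ v (σ i)) = iteratedFDeriv ℝ k f a v :=
    (hf.of_le (by exact_mod_cast hk)).iteratedFDeriv_comp_perm_of_real v σ
  rw [(hasFiniteFPowerSeriesOnBall_taylorPolynomialSeries f n
    a).toHasFPowerSeriesOnBall.iteratedFDeriv_eq_sum_of_completeSpace]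
  simp only [taylorPolynomialSeries, if_pos hk, smul_apply, h_perm,
    Finset.sum_const, Finset.card_univ, Fintype.card_perm, Fintype.card_fin]
  rw [← Nat.cast_smul_eq_nsmul ℝ, smul_smul, mul_inv_cancel₀ (by positivity), one_smul]

open Set Filter Topology

/-- Taylor remainder estimate for the derivatives of the Taylor polynomial. -/
theorem taylor_derivative_estimate {p n : ℕ} {E : Type*} [NormedAddCommGroup E]
    [NormedSpace ℝ E] [CompleteSpace E] {Ω : Set (Fin p → ℝ)}
    (hΩ : IsOpen Ω) (hΩne : Ω.Nonempty) (hn : 1 ≤ n)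
    (f : (Fin p → ℝ) → E) (hf : ContDiffOn ℝ n f Ω)
    (a : Fin p → ℝ) (ha : a ∈ Ω) (r : ℝ) (hr : 0 < r)
    (hball : Metric.closedBall a r ⊆ Ω)
    (i : ℕ) (hi : i ≤ n) (b : Fin p → ℝ) (hb : ‖b - a‖ < r) :
    ‖iteratedFDeriv ℝ i
        (fun z => ∑ k ∈ Finset.range (n + 1),
          ((k.factorial : ℝ))⁻¹ • iteratedFDeriv ℝ k f a (fun _ => z - a)) b
      - iteratedFDeriv ℝ i f b‖
    ≤ ‖b - a‖ ^ (n - i) / ((n - i).factorial : ℝ) *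
        ⨆ x : (Metric.closedBall a r : Set (Fin p → ℝ)),
          ‖iteratedFDeriv ℝ n f ↑x - iteratedFDeriv ℝ n f a‖ := by
  set P : (Fin p → ℝ) → E := fun z => ∑ k ∈ Finset.range (n + 1),
    ((k.factorial : ℝ))⁻¹ • iteratedFDeriv ℝ k f a (fun _ => z - a) with hP
  have hPseries := hasFiniteFPowerSeriesOnBall_taylorPolynomialSeries f n a
  rw [← hP] at hPseries
  have hPdiff (m : ℕ) (x : Fin p → ℝ) : ContDiffAt ℝ m P x :=
    (hPseries.toHasFPowerSeriesOnBall.analyticAt_of_mem (by simp)).contDiffAt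
  have hPself {k : ℕ} (hk : k ≤ n) : iteratedFDeriv ℝ k P a = iteratedFDeriv ℝ k f a :=
    iteratedFDeriv_taylorPolynomial_self (hf.contDiffAt (hΩ.mem_nhds ha)) hk
  have hPtop (x : Fin p → ℝ) : iteratedFDeriv ℝ n P x = iteratedFDeriv ℝ n f a := by
    rw [← hPself le_rfl]
    rw [add_comm] at hPseries
    exact hPseries.iteratedFDeriv.eq_const_of_bound_one x (by simp)
  have hfdiff {x : Fin p → ℝ} (hx : x ∈ Metric.closedBall a r) : ContDiffAt ℝ n f x :=
    hf.contDiffAt (hΩ.mem_nhds (hball hx))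
  have h_sub {k : ℕ} (hk : k ≤ n) {x : Fin p → ℝ} (hx : x ∈ Metric.closedBall a r) :
      iteratedFDeriv ℝ k (P - f) x = iteratedFDeriv ℝ k P x - iteratedFDeriv ℝ k f x :=
    iteratedFDeriv_sub_apply (hPdiff k x) ((hfdiff hx).of_le (by exact_mod_cast hk))
  have h_bdd : BddAbove (range fun x : (Metric.closedBall a r : Set (Fin p → ℝ)) ↦
      ‖iteratedFDeriv ℝ n f ↑x - iteratedFDeriv ℝ n f a‖) := by
    have h_cont : ContinuousOn (fun x ↦ ‖iteratedFDeriv ℝ n f x - iteratedFDeriv ℝ n f a‖)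
        (Metric.closedBall a r) := fun x hx ↦
      (((hfdiff hx).continuousAt_iteratedFDeriv le_rfl).sub
        continuousAt_const).norm.continuousWithinAt
    simpa only [image_eq_range] using (isCompact_closedBall a r).bddAbove_image h_cont
  have hb' : b ∈ Metric.ball a r := mem_ball_iff_norm.2 hb
  rw [← h_sub hi (Metric.ball_subset_closedBall hb')]
  refine norm_iteratedFDeriv_le_of_eq_zero_at_center (g := P - f)
    (fun x hx ↦ (hPdiff n x).sub (hfdiff (Metric.ball_subset_closedBall hx)))
    (fun k hk ↦ ?_) (fun x hx ↦ ?_) (Nat.add_sub_of_le hi) hb'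
  · rw [h_sub hk.le (Metric.mem_closedBall_self hr.le), hPself hk.le, sub_self]
  · rw [h_sub le_rfl (Metric.ball_subset_closedBall hx), hPtop, norm_sub_rev]
    exact le_ciSup h_bdd ⟨x, Metric.ball_subset_closedBall hx⟩
end

section
/- Let E, F be real Banach spaces, Ω, Ω' ⊆ ℝ^p nonempty open sets, n ≥ 1, and let T : C^n(Ω, E) → C^n(Ω', F) be an ℝ-linear biseparating map. Assume h : Ω' → Ω is a homeomorphism and J is a map from Ω' into the (not necessarily continuous) bijective linear maps from E onto F such that (Tf)(y) = (Jy)(f(h(y))) for every y ∈ Ω' and every f ∈ C^n(Ω, E). Then for every nonempty bounded open set U ⊆ Ω' whose closure in ℝ^p is contained in Ω', the set {y ∈ U : Jy is not continuous} is finite. -/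
open Set Filter Topology

/-- The space `C^n(Ω, E)`, as a submodule of the functions `ℝ^p → E`. -/
def Cspace (p n : ℕ) (Ω : Set (Fin p → ℝ)) (E : Type*) [NormedAddCommGroup E]
    [NormedSpace ℝ E] : Submodule ℝ ((Fin p → ℝ) → E) where
  carrier := {f | ContDiffOn ℝ n f Ω}
  add_mem' hf hg := hf.add hg
  zero_mem' := contDiffOn_const
  smul_mem' c f hf := hf.const_smul c

/-- A discontinuous linear map takes arbitrarily large values on every ball around `0`. -/
theorem exists_small_vector_large_image {E F : Type*}
    [NormedAddCommGroup E] [NormedSpace ℝ E] [NormedAddCommGroup F] [NormedSpace ℝ F]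
    (L : E →ₗ[ℝ] F) (hL : ¬ Continuous L) {ε : ℝ} (hε : 0 < ε) (K : ℝ) :
    ∃ e : E, ‖e‖ ≤ ε ∧ K ≤ ‖L e‖ := by
  by_contra! hc
  refine hL ?_
  obtain ⟨C, hC⟩ := LinearMap.bound_of_ball_bound hε K L fun z hz =>
    (hc z (mem_ball_zero_iff.1 hz).le).le
  exact AddMonoidHomClass.continuous_of_bound L C hC

/-- The derivatives up to order `n` of a smooth bump function are uniformly bounded. -/
theorem ContDiffBump.exists_iteratedFDeriv_bound {V : Type*} [NormedAddCommGroup V]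
    [NormedSpace ℝ V] [FiniteDimensional ℝ V] {c : V} (φ : ContDiffBump c) (n : ℕ) :
    ∃ M : ℝ, 0 < M ∧ ∀ i ≤ n, ∀ x, ‖iteratedFDeriv ℝ i φ x‖ ≤ M := by
  have hφ (i : ℕ) : ∃ C, ∀ x, ‖iteratedFDeriv ℝ i φ x‖ ≤ C :=
    (φ.contDiff.continuous_iteratedFDeriv (n := i) le_rfl).bounded_above_of_compact_support
      (φ.hasCompactSupport.iteratedFDeriv i)
  choose C hC using hφ
  refine ⟨∑ i ∈ Finset.range (n + 1), C i + 1, ?_, fun i hi x => ?_⟩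
  · have := Finset.sum_nonneg fun i (_ : i ∈ Finset.range (n + 1)) =>
      (norm_nonneg _).trans (hC i c)
    linarith
  · have := Finset.single_le_sum (fun i _ => (norm_nonneg _).trans (hC i c))
      (Finset.mem_range.2 (Nat.lt_succ_of_le hi))
    linarith [hC i x]

/-- Sufficiently small vectors prescribed at isolated points of a sequence are interpolated by
a `C^n` function. -/
theorem exists_contDiff_interpolation {V E : Type*} [NormedAddCommGroup V] [NormedSpace ℝ V]
    [FiniteDimensional ℝ V] [NormedAddCommGroup E] [NormedSpace ℝ E] [CompleteSpace E]
    (n : ℕ) (x : ℕ → V) (hx : ∀ j, ∃ r > 0, ∀ k, dist (x k) (x j) < r → k = j) :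
    ∃ δ : ℕ → ℝ, (∀ k, 0 < δ k) ∧ ∀ e : ℕ → E, (∀ k, ‖e k‖ ≤ δ k) →
      ∃ f : V → E, ContDiff ℝ n f ∧ ∀ k, f (x k) = e k := by
  choose r hr hxr using hx
  let φ (k : ℕ) : ContDiffBump (x k) := ⟨r k / 2, r k, half_pos (hr k), half_lt_self (hr k)⟩
  choose M hM hφM using fun k => (φ k).exists_iteratedFDeriv_bound n
  refine ⟨fun k => (1 / 2 : ℝ) ^ k / M k, fun k => div_pos (by positivity) (hM k),
    fun e he => ⟨fun z => ∑' k, φ k z • e k, ?_, fun k => ?_⟩⟩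
  · refine contDiff_tsum (N := n) (v := fun _ k => (1 / 2 : ℝ) ^ k)
      (fun k => (φ k).contDiff.smul contDiff_const) (fun _ _ => summable_geometric_two)
      fun i k z hi => ?_
    calc ‖iteratedFDeriv ℝ i (fun z => φ k z • e k) z‖
        ≤ ‖ContinuousLinearMap.toSpanSingleton ℝ (e k)‖ * ‖iteratedFDeriv ℝ i (φ k) z‖ :=
          ContinuousLinearMap.norm_iteratedFDeriv_comp_left
            (ContinuousLinearMap.toSpanSingleton ℝ (e k)) (φ k).contDiff.contDiffAt le_rfl
      _ ≤ (1 / 2 : ℝ) ^ k / M k * M k := by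
          rw [ContinuousLinearMap.norm_toSpanSingleton]
          exact mul_le_mul (he k) (hφM k i (by exact_mod_cast hi) z) (norm_nonneg _)
            (div_pos (by positivity) (hM k)).le
      _ = (1 / 2 : ℝ) ^ k := div_mul_cancel₀ _ (hM k).ne'
  · have hself : φ k (x k) = 1 := (φ k).one_of_mem_closedBall (Metric.mem_closedBall_self (φ k).rIn_pos.le)
    refine (tsum_eq_single k ?_).trans (by rw [hself, one_smul])
    intro j hj
    rw [(φ j).zero_of_le_dist, zero_smul]
    by_contra! hlt
    exact hj (hxr j k hlt).symm

/-- Every infinite set in a metric space contains a sequence of pairwise distinct points, each of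
which is isolated from the others. -/
theorem Set.Infinite.exists_isolated_seq {V : Type*} [MetricSpace V] {S : Set V}
    (hS : S.Infinite) :
    ∃ x : ℕ → V, (∀ k, x k ∈ S) ∧ ∀ j, ∃ r > 0, ∀ k, dist (x k) (x j) < r → k = j := by
  have := hS.to_subtype
  obtain ⟨A, hA, hdisc⟩ := exists_infinite_discreteTopology S
  refine ⟨fun k => (hA.natEmbedding A k : S), fun k => Subtype.prop _, fun j => ?_⟩
  obtain ⟨r, hr, hrA⟩ := Metric.isOpen_singleton_iff.1
    (isOpen_discrete {hA.natEmbedding A j})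
  exact ⟨r, hr, fun k hk => (hA.natEmbedding A).injective (hrA _ hk)⟩

/-- for a linear biseparating map represented as `(Tf)(y) = (Jy)(f(h(y)))`, the
set of points of a bounded open set `U` with closure inside `Ω'` at which `Jy` fails to be
continuous is finite. -/
theorem discontinuity_set_finite {p n : ℕ} {E F : Type*}
    [NormedAddCommGroup E] [NormedSpace ℝ E] [CompleteSpace E]
    [NormedAddCommGroup F] [NormedSpace ℝ F] [CompleteSpace F]
    {Ω Ω' : Set (Fin p → ℝ)}
    (hΩ : IsOpen Ω) (hΩne : Ω.Nonempty) (hΩ' : IsOpen Ω') (hΩ'ne : Ω'.Nonempty)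
    (hn : 1 ≤ n)
    (T : Cspace p n Ω E →ₗ[ℝ] Cspace p n Ω' F)
    (hbij : Function.Bijective T)
    (hsep : ∀ f g : Cspace p n Ω E, (∀ x ∈ Ω, f.1 x = 0 ∨ g.1 x = 0) →
      ∀ y ∈ Ω', (T f).1 y = 0 ∨ (T g).1 y = 0)
    (hsep' : ∀ f g : Cspace p n Ω E, (∀ y ∈ Ω', (T f).1 y = 0 ∨ (T g).1 y = 0) →
      ∀ x ∈ Ω, f.1 x = 0 ∨ g.1 x = 0)
    -- `h` is a homeomorphism from `Ω'` onto `Ω`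
    (h : (Fin p → ℝ) → (Fin p → ℝ)) (h' : (Fin p → ℝ) → (Fin p → ℝ))
    (hh : ContinuousOn h Ω') (hh' : ContinuousOn h' Ω) (hhBij : Set.BijOn h Ω' Ω)
    (hinv1 : ∀ y ∈ Ω', h' (h y) = y) (hinv2 : ∀ x ∈ Ω, h (h' x) = x)
    -- `J` maps `Ω'` into the (not necessarily continuous) bijective linear maps `E → F`
    (J : (Fin p → ℝ) → (E →ₗ[ℝ] F))
    (hJbij : ∀ y ∈ Ω', Function.Bijective (J y))
    (hrep : ∀ f : Cspace p n Ω E, ∀ y ∈ Ω', (T f).1 y = J y (f.1 (h y))) :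
    ∀ U : Set (Fin p → ℝ), U.Nonempty → IsOpen U → Bornology.IsBounded U →
      closure U ⊆ Ω' →
      {y ∈ U | ¬ Continuous (J y)}.Finite := by
  intro U _ _ hUb hUcl
  by_contra hinf
  have hUΩ : U ⊆ Ω' := subset_closure.trans hUcl
  obtain ⟨x, hxS, hx⟩ := (Set.Infinite.image
    (hhBij.injOn.mono fun _ hy => hUΩ hy.1) hinf).exists_isolated_seq
  choose y hy hyx using hxS
  obtain ⟨δ, hδ, hinterp⟩ := exists_contDiff_interpolation (E := E) n x hx
  choose e heδ heJ using fun k : ℕ =>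
    exists_small_vector_large_image (J (y k)) (hy k).2 (hδ k) (k : ℝ)
  obtain ⟨f, hf, hfx⟩ := hinterp e heδ
  let f' : Cspace p n Ω E := ⟨f, hf.contDiffOn⟩
  have hcont : ContinuousOn (T f').1 (closure U) :=
    (show ContDiffOn ℝ n (T f').1 Ω' from (T f').2).continuousOn.mono hUcl
  obtain ⟨C, hC⟩ := hUb.isCompact_closure.exists_bound_of_continuousOn hcont
  obtain ⟨k, hk⟩ := exists_nat_gt C
  have hTf := hrep f' (y k) (hUΩ (hy k).1)
  rw [hyx k, show f'.1 (x k) = e k from hfx k] at hTf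
  have hle := hC (y k) (subset_closure (hy k).1)
  rw [hTf] at hle
  linarith [heJ k]
end

section
/- Let E, F be real Banach spaces, Ω ⊆ ℝ^p and Ω' ⊆ ℝ^q nonempty open sets, n, m ≥ 1, and let T : C^n(Ω, E) → C^m(Ω', F) be a biseparating map. Then for every e ∈ E with e ≠ 0, the cozero set c(T ê) = {y ∈ Ω' : (T ê)(y) ≠ 0} of the image of the constant function ê ≡ e is dense in Ω'. -/
open Set Filter Topology

/-- for a biseparating (additive, bijective, with `T` and `T⁻¹` separating) map
`T : C^n(Ω, E) → C^m(Ω', F)` and every `e ≠ 0`, the cozero set of the image `T ê` of the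
constant function `ê ≡ e` is dense in `Ω'`. -/
theorem cozero_of_image_of_constant_dense {p q n m : ℕ} {E F : Type*}
    [NormedAddCommGroup E] [NormedSpace ℝ E] [CompleteSpace E]
    [NormedAddCommGroup F] [NormedSpace ℝ F] [CompleteSpace F]
    {Ω : Set (Fin p → ℝ)} {Ω' : Set (Fin q → ℝ)}
    (hΩ : IsOpen Ω) (hΩne : Ω.Nonempty) (hΩ' : IsOpen Ω') (hΩ'ne : Ω'.Nonempty)
    (hn : 1 ≤ n) (hm : 1 ≤ m)
    (T : Cspace p n Ω E → Cspace q m Ω' F)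
    (hadd : ∀ f g : Cspace p n Ω E, T (f + g) = T f + T g)
    (hbij : Function.Bijective T)
    (hsep : ∀ f g : Cspace p n Ω E, (∀ x ∈ Ω, f.1 x = 0 ∨ g.1 x = 0) →
      ∀ y ∈ Ω', (T f).1 y = 0 ∨ (T g).1 y = 0)
    (hsep' : ∀ f g : Cspace p n Ω E, (∀ y ∈ Ω', (T f).1 y = 0 ∨ (T g).1 y = 0) →
      ∀ x ∈ Ω, f.1 x = 0 ∨ g.1 x = 0) :
    ∀ e : E, e ≠ 0 →
      Ω' ⊆ closure {y ∈ Ω' | (T ⟨fun _ => e, contDiffOn_const⟩).1 y ≠ 0} := by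
  intro e he y hy
  by_contra hcl
  set c : Cspace p n Ω E := ⟨fun _ => e, contDiffOn_const⟩
  obtain ⟨x₀, hx₀⟩ := hΩne
  have hF : ∃ v : F, v ≠ 0 := by
    by_contra! h
    exact (hsep' c c (fun y _ => Or.inl (h _)) x₀ hx₀).elim he he
  obtain ⟨v, hv⟩ := hF
  obtain ⟨φ, hφsupp, -, hφ, -, hφy⟩ := exists_contDiff_tsupport_subset (n := m)
    (isClosed_closure.isOpen_compl.mem_nhds hcl)
  obtain ⟨f, hf⟩ := hbij.2
    ⟨fun z => φ z • v, (hφ.smul contDiff_const).contDiffOn⟩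
  have hf₀ : ∀ x ∈ Ω, f.1 x = 0 := by
    refine fun x hx => (hsep' c f (fun z hz => ?_) x hx).resolve_left he
    by_contra! h
    refine hφsupp (subset_tsupport φ fun h₀ => h.2 ?_) (subset_closure ⟨hz, h.1⟩)
    simp [hf, h₀]
  have hTf := (hsep f f (fun x hx => Or.inl (hf₀ x hx)) y hy).elim id id
  rw [hf] at hTf
  simp [hφy, hv] at hTf
end
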